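/- arXiv:1012.3897 — 3 statements merged into one kernel-verified Lean document; each statement's English description precedes it below -/
import Mathlib

section
/- Let ε > 0 be a real number such that for all odd primes p < q < r the height of Φ_{pqr} is at most ε·p. Then for all odd primes p < q < r < s, the height of Φ_{pqrs} is at most ε·p³q. -/
open Polynomial

/-- The height of an integer polynomial: the maximum of the absolute values of its
coefficients (`0` for the zero polynomial). -/
noncomputable def polyHeight (f : ℤ[X]) : ℕ := f.support.sup fun m => (f.coeff m).natAbs

/-- `A n` is the height of the `n`-th cyclotomic polynomial. -/
noncomputable def A (n : ℕ) : ℕ := polyHeight (cyclotomic n ℤ)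

theorem natAbs_coeff_le_polyHeight (f : ℤ[X]) (n : ℕ) : (f.coeff n).natAbs ≤ polyHeight f := by
  by_cases h : f.coeff n = 0
  · simp [h]
  · exact Finset.le_sup (f := fun m => (f.coeff m).natAbs) (mem_support_iff.2 h)

theorem polyHeight_le_of_forall {f : ℤ[X]} {B : ℕ} (h : ∀ n, (f.coeff n).natAbs ≤ B) :
    polyHeight f ≤ B :=
  Finset.sup_le fun n _ => h n

/-- The sum of the absolute values of the coefficients of an integer polynomial. -/
noncomputable def coeffL1 (f : ℤ[X]) : ℕ := ∑ i ∈ f.support, (f.coeff i).natAbs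

theorem coeffL1_eq_of_support_subset {f : ℤ[X]} {s : Finset ℕ} (h : f.support ⊆ s) :
    coeffL1 f = ∑ i ∈ s, (f.coeff i).natAbs :=
  Finset.sum_subset h fun i _ hi => by simpa using hi

theorem coeffL1_add_le (f g : ℤ[X]) : coeffL1 (f + g) ≤ coeffL1 f + coeffL1 g := by
  rw [coeffL1_eq_of_support_subset (support_add (p := f) (q := g)),
    coeffL1_eq_of_support_subset (Finset.subset_union_left (s₁ := f.support) (s₂ := g.support)),
    coeffL1_eq_of_support_subset (Finset.subset_union_right (s₁ := f.support) (s₂ := g.support)),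
    ← Finset.sum_add_distrib]
  exact Finset.sum_le_sum fun i _ => by simpa using Int.natAbs_add_le _ _

theorem coeffL1_neg (f : ℤ[X]) : coeffL1 (-f) = coeffL1 f := by
  simp [coeffL1]

theorem coeffL1_sub_le (f g : ℤ[X]) : coeffL1 (f - g) ≤ coeffL1 f + coeffL1 g := by
  simpa [sub_eq_add_neg, coeffL1_neg] using coeffL1_add_le f (-g)

theorem coeffL1_sum_le {ι : Type*} (s : Finset ι) (f : ι → ℤ[X]) :
    coeffL1 (∑ i ∈ s, f i) ≤ ∑ i ∈ s, coeffL1 (f i) :=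
  Finset.le_sum_of_subadditive coeffL1 (by simp [coeffL1]) coeffL1_add_le s f

theorem coeffL1_monomial (n : ℕ) (a : ℤ) : coeffL1 (monomial n a) = a.natAbs := by
  rw [coeffL1_eq_of_support_subset (support_monomial_subset n a)]
  simp

theorem coeffL1_X_pow (n : ℕ) : coeffL1 (X ^ n) = 1 := by
  rw [← monomial_one_right_eq_X_pow, coeffL1_monomial, Int.natAbs_one]

theorem coeffL1_mul_le (f g : ℤ[X]) : coeffL1 (f * g) ≤ coeffL1 f * coeffL1 g := by
  rw [mul_eq_sum_sum]
  simp only [Polynomial.sum]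
  refine (coeffL1_sum_le _ _).trans ?_
  rw [coeffL1, coeffL1, Finset.sum_mul_sum]
  refine Finset.sum_le_sum fun i _ => (coeffL1_sum_le _ _).trans ?_
  simp [coeffL1_monomial, Int.natAbs_mul]

theorem coeffL1_geom_sum_le (m k : ℕ) :
    coeffL1 (∑ i ∈ Finset.range k, ((X : ℤ[X]) ^ m) ^ i) ≤ k := by
  refine (coeffL1_sum_le _ _).trans ?_
  simp [← pow_mul, coeffL1_X_pow]

theorem polyHeight_mul_le (f g : ℤ[X]) : polyHeight (f * g) ≤ polyHeight f * coeffL1 g := by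
  refine polyHeight_le_of_forall fun n => ?_
  conv_lhs => rw [g.as_sum_support, Finset.mul_sum, finsetSum_coeff]
  refine (Int.natAbs_sum_le _ _).trans ?_
  rw [coeffL1, Finset.mul_sum]
  refine Finset.sum_le_sum fun i _ => ?_
  rw [← C_mul_X_pow_eq_monomial, ← mul_assoc, coeff_mul_X_pow']
  split_ifs
  · rw [coeff_mul_C, Int.natAbs_mul]
    exact Nat.mul_le_mul_right _ (natAbs_coeff_le_polyHeight f _)
  · simp

/-- Shifts of `f(X ^ s)` by multiples of `N` do not overlap when `s` is coprime to `N` and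
`deg f < N`. -/
theorem polyHeight_expand_mul_geom_sum_le {f : ℤ[X]} {s N : ℕ} (hs : 0 < s)
    (hsN : s.Coprime N) (hf : f.natDegree < N) (K : ℕ) :
    polyHeight (expand ℤ s f * ∑ k ∈ Finset.range K, (X ^ N) ^ k) ≤ polyHeight f := by
  refine polyHeight_le_of_forall fun n => ?_
  have hterm : ∀ k, (expand ℤ s f * (X ^ N) ^ k).coeff n =
      if N * k ≤ n ∧ s ∣ n - N * k then f.coeff ((n - N * k) / s) else 0 := by
    intro k
    rw [← pow_mul, coeff_mul_X_pow', coeff_expand hs]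
    split_ifs <;> tauto
  rw [Finset.mul_sum, finsetSum_coeff]
  simp only [hterm]
  by_cases h : ∃ k ∈ Finset.range K,
      (if N * k ≤ n ∧ s ∣ n - N * k then f.coeff ((n - N * k) / s) else 0) ≠ 0
  · obtain ⟨k, hk, hne⟩ := h
    rw [Finset.sum_eq_single_of_mem k hk]
    · split_ifs
      · exact natAbs_coeff_le_polyHeight f _
      · simp
    · intro l _ hlk
      by_contra hl
      simp only [ne_eq, ite_eq_right_iff, Classical.not_imp] at hne hl
      obtain ⟨⟨hk1, a, ha⟩, hk3⟩ := hne
      obtain ⟨⟨hl1, b, hb⟩, hl3⟩ := hl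
      rw [ha, Nat.mul_div_cancel_left _ hs] at hk3
      rw [hb, Nat.mul_div_cancel_left _ hs] at hl3
      have ha' : a < N := (le_natDegree_of_ne_zero hk3).trans_lt hf
      have hb' : b < N := (le_natDegree_of_ne_zero hl3).trans_lt hf
      have hab : N * k + s * a = N * l + s * b := by omega
      have hmod : s * a ≡ s * b [MOD N] := by
        have h1 : (N * k + s * a) % N = (N * l + s * b) % N := by rw [hab]
        simpa [Nat.ModEq] using h1
      have hab' : a = b :=
        (Nat.ModEq.cancel_left_of_coprime hsN.symm hmod).eq_of_lt_of_lt ha' hb'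
      subst hab'
      exact hlk (Nat.eq_of_mul_eq_mul_left (by omega) (by omega : N * l = N * k))
  · push Not at h
    rw [Finset.sum_eq_zero h]
    simp

/-- If `Φ_N * ψ = X ^ N - 1`, adjoining a new prime factor to `N` multiplies the height of the
cyclotomic polynomial by at most the sum of the absolute values of the coefficients of `ψ`. -/
theorem A_mul_prime_le {N s : ℕ} (hN : 1 < N) (hs : s.Prime) (hsN : ¬ s ∣ N) {ψ : ℤ[X]}
    (hψ : cyclotomic N ℤ * ψ = X ^ N - 1) : A (N * s) ≤ A N * coeffL1 ψ := by
  refine polyHeight_le_of_forall fun n => ?_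
  set G : ℤ[X] := ∑ k ∈ Finset.range (n + 1), (X ^ N) ^ k
  have hG : G * (X ^ N - 1) = X ^ (N * (n + 1)) - 1 := by
    rw [geom_sum_mul, ← pow_mul]
  have hexp := cyclotomic_expand_eq_cyclotomic_mul hs hsN ℤ
  have key : cyclotomic (N * s) ℤ * X ^ (N * (n + 1)) - cyclotomic (N * s) ℤ =
      expand ℤ s (cyclotomic N ℤ) * G * ψ := by
    linear_combination (-cyclotomic (N * s) ℤ) * hG - cyclotomic (N * s) ℤ * G * hψ
      - G * ψ * hexp
  have hlt : ¬ N * (n + 1) ≤ n := by nlinarith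
  have hc := congrArg (fun f => (f.coeff n).natAbs) key
  simp only [coeff_sub, coeff_mul_X_pow', if_neg hlt, zero_sub, Int.natAbs_neg] at hc
  rw [hc]
  refine (natAbs_coeff_le_polyHeight _ n).trans ((polyHeight_mul_le _ _).trans ?_)
  refine Nat.mul_le_mul_right _ (polyHeight_expand_mul_geom_sum_le hs.pos
    ((Nat.Prime.coprime_iff_not_dvd hs).2 hsN) ?_ _)
  rw [natDegree_cyclotomic]
  exact Nat.totient_lt N hN

theorem X_pow_sub_one_ne_zero_int {n : ℕ} (hn : 0 < n) : (X ^ n - 1 : ℤ[X]) ≠ 0 :=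
  (monic_X_pow_sub_C (1 : ℤ) hn.ne').ne_zero

theorem cyclotomic_mul_of_two_primes {p q : ℕ} (hp : p.Prime) (hq : q.Prime) (hpq : p ≠ q) :
    cyclotomic (p * q) ℤ * ((X ^ p - 1) * (X ^ q - 1)) = (X ^ (p * q) - 1) * (X - 1) := by
  have := Fact.mk hp
  have h1 := cyclotomic_prime_mul_X_sub_one ℤ p
  have h2 := cyclotomic_expand_eq_cyclotomic_mul hq
    (fun h => hpq ((Nat.prime_dvd_prime_iff_eq hq hp).1 h).symm) ℤ
  have h3 := congrArg (expand ℤ q) h1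
  simp only [map_mul, map_sub, map_pow, map_one, expand_X, ← pow_mul, mul_comm q p] at h3
  linear_combination (-cyclotomic (p * q) ℤ) * (X ^ q - 1) * h1 + (X - 1) * h3
    - (X - 1) * (X ^ q - 1) * h2

theorem exists_mul_add_mul_eq_mul_add_one {p q : ℕ} (hp : 1 < p) (hq : 1 < q)
    (hpq : p.Coprime q) : ∃ u v, u < q ∧ v < p ∧ u * p + v * q = p * q + 1 := by
  obtain ⟨u, hu, hu1⟩ := Nat.exists_mul_mod_eq_one_of_coprime hpq hq
  have hupos : 0 < u := Nat.pos_of_ne_zero fun h => by simp [h] at hu1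
  have hdiv := Nat.div_add_mod (p * u) q
  rw [hu1] at hdiv
  have hle : p * u / q < p := by
    apply Nat.div_lt_of_lt_mul
    nlinarith
  have hpos : 0 < p * u / q := by
    refine Nat.pos_of_ne_zero fun h => ?_
    rw [h] at hdiv
    nlinarith
  obtain ⟨v, hv⟩ := Nat.exists_eq_add_of_lt hle
  refine ⟨u, v + 1, hu, by omega, ?_⟩
  generalize p * u / q = w at *
  subst hv
  nlinarith

theorem cyclotomic_two_primes_eq {p q u v : ℕ} (hp : p.Prime) (hq : q.Prime) (hpq : p ≠ q)
    (hu : u < q) (hv : v < p) (huv : u * p + v * q = p * q + 1) :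
    cyclotomic (p * q) ℤ =
      (∑ i ∈ Finset.range u, (X ^ p) ^ i) * (∑ j ∈ Finset.range v, (X ^ q) ^ j) -
      X ^ 1 * ((∑ i ∈ Finset.range (q - u), (X ^ p) ^ i) *
        ∑ j ∈ Finset.range (p - v), (X ^ q) ^ j) := by
  refine mul_right_cancel₀ (mul_ne_zero (X_pow_sub_one_ne_zero_int hp.pos)
    (X_pow_sub_one_ne_zero_int hq.pos)) ?_
  rw [cyclotomic_mul_of_two_primes hp hq hpq]
  have h1 := geom_sum_mul ((X : ℤ[X]) ^ p) u
  have h2 := geom_sum_mul ((X : ℤ[X]) ^ q) v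
  have h3 := geom_sum_mul ((X : ℤ[X]) ^ p) (q - u)
  have h4 := geom_sum_mul ((X : ℤ[X]) ^ q) (p - v)
  obtain ⟨a, rfl⟩ := Nat.exists_eq_add_of_lt hu
  obtain ⟨b, rfl⟩ := Nat.exists_eq_add_of_lt hv
  generalize hP : v + b + 1 = p at *
  generalize hQ : u + a + 1 = q at *
  have e3 : q - u = a + 1 := by omega
  have e4 : p - v = b + 1 := by omega
  rw [e3] at h3 ⊢
  rw [e4] at h4 ⊢
  -- exponents: `p * u = 1 + q * (b + 1)` and `q * v = 1 + p * (a + 1)`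
  have hA : p * u = 1 + q * (b + 1) := by
    have : p * q = v * q + (b + 1) * q := by rw [← hP]; ring
    nlinarith
  have hB : q * v = 1 + p * (a + 1) := by
    have : p * q = u * p + (a + 1) * p := by rw [← hQ]; ring
    nlinarith
  have hC : p * q = 1 + q * (b + 1) + p * (a + 1) := by
    have : p * q = u * p + (a + 1) * p := by rw [← hQ]; ring
    nlinarith
  rw [← pow_mul, hA] at h1
  rw [← pow_mul, hB] at h2
  rw [← pow_mul] at h3 h4
  rw [hC]
  simp only [pow_add _ 1, pow_add _ (1 + _), pow_one] at h1 h2 ⊢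
  generalize (X : ℤ[X]) ^ (q * (b + 1)) = s at *
  generalize (X : ℤ[X]) ^ (p * (a + 1)) = t at *
  generalize (∑ i ∈ Finset.range u, ((X : ℤ[X]) ^ p) ^ i) = f1 at *
  generalize (∑ i ∈ Finset.range v, ((X : ℤ[X]) ^ q) ^ i) = f2 at *
  generalize (∑ i ∈ Finset.range (a + 1), ((X : ℤ[X]) ^ p) ^ i) = f3 at *
  generalize (∑ i ∈ Finset.range (b + 1), ((X : ℤ[X]) ^ q) ^ i) = f4 at *
  linear_combination (-f2 * (X ^ q - 1)) * h1 - (X * s - 1) * h2 + X * f4 * (X ^ q - 1) * h3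
    + X * (t - 1) * h4

theorem two_mul_coeffL1_cyclotomic_two_primes_le {p q : ℕ} (hp : p.Prime) (hq : q.Prime)
    (hpq : p ≠ q) : 2 * coeffL1 (cyclotomic (p * q) ℤ) ≤ p * q := by
  obtain ⟨u, v, hu, hv, huv⟩ := exists_mul_add_mul_eq_mul_add_one hp.one_lt hq.one_lt
    ((Nat.coprime_primes hp hq).2 hpq)
  have hnorm : coeffL1 (cyclotomic (p * q) ℤ) ≤ u * v + (q - u) * (p - v) := by
    rw [cyclotomic_two_primes_eq hp hq hpq hu hv huv]
    refine (coeffL1_sub_le _ _).trans (add_le_add ?_ ?_)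
    · exact (coeffL1_mul_le _ _).trans
        (Nat.mul_le_mul (coeffL1_geom_sum_le _ _) (coeffL1_geom_sum_le _ _))
    · refine (coeffL1_mul_le _ _).trans ?_
      rw [coeffL1_X_pow, one_mul]
      exact (coeffL1_mul_le _ _).trans
        (Nat.mul_le_mul (coeffL1_geom_sum_le _ _) (coeffL1_geom_sum_le _ _))
  refine (Nat.mul_le_mul_left 2 hnorm).trans ?_
  have hpq4 : 1 < p * q := Nat.one_lt_mul_iff.2 ⟨hp.pos, hq.pos, Or.inl hp.one_lt⟩
  zify [hu.le, hv.le] at huv hpq4 ⊢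
  have hcount : (u * v + (q - u) * (p - v) : ℤ) = 2 * (u * v) - 1 := by linarith
  rw [hcount]
  -- AM-GM applied to `u * p` and `v * q`
  have hamgm : 4 * ((u : ℤ) * v) * (p * q) ≤ (p * q + 1) ^ 2 := by
    rw [← huv]
    nlinarith [sq_nonneg ((u : ℤ) * p - v * q)]
  by_contra! hcon
  nlinarith

theorem cyclotomic_three_primes_mul {p q r : ℕ} (hp : p.Prime) (hq : q.Prime) (hr : r.Prime)
    (hpq : p ≠ q) (hpr : p ≠ r) (hqr : q ≠ r) :
    cyclotomic (p * q * r) ℤ * (cyclotomic (p * q) ℤ *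
      (∑ i ∈ Finset.range p, (X ^ r) ^ i) * (X ^ (q * r) - X ^ 0)) = X ^ (p * q * r) - 1 := by
  refine mul_right_cancel₀ (X_pow_sub_one_ne_zero_int hr.pos) ?_
  have hdvd : ¬ r ∣ p * q := by
    rw [hr.dvd_mul, Nat.prime_dvd_prime_iff_eq hr hp, Nat.prime_dvd_prime_iff_eq hr hq]
    tauto
  have h1 := geom_sum_mul ((X : ℤ[X]) ^ r) p
  have h2 := cyclotomic_expand_eq_cyclotomic_mul hr hdvd ℤ
  have h3 := congrArg (expand ℤ r) (cyclotomic_mul_of_two_primes hp hq hpq)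
  simp only [map_mul, map_sub, map_pow, map_one, expand_X] at h3
  rw [h2] at h3
  simp only [← pow_mul, mul_comm r, pow_zero] at h1 h3 ⊢
  linear_combination cyclotomic (p * q * r) ℤ * cyclotomic (p * q) ℤ * (X ^ (q * r) - 1) * h1 + h3

/-- **Lemma 4 (Bzdęga).** If `ε > 0` is such that `A (pqr) ≤ ε·p` for all odd primes
`p < q < r`, then `A (pqrs) ≤ ε·p³q` for all odd primes `p < q < r < s`. -/
theorem height_cyclotomic_stmt7 (ε : ℝ) (hε : 0 < ε)
    (h3 : ∀ p q r : ℕ, p.Prime → q.Prime → r.Prime → Odd p → Odd q → Odd r →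
      p < q → q < r → (A (p * q * r) : ℝ) ≤ ε * p) :
    ∀ p q r s : ℕ, p.Prime → q.Prime → r.Prime → s.Prime →
      Odd p → Odd q → Odd r → Odd s → p < q → q < r → r < s →
      (A (p * q * r * s) : ℝ) ≤ ε * (p : ℝ) ^ 3 * q := by
  intro p q r s hp hq hr hs hop hoq hor _ hpq hqr hrs
  have hN : 1 < p * q * r :=
    Nat.one_lt_mul_iff.2 ⟨Nat.mul_pos hp.pos hq.pos, hr.pos, Or.inr hr.one_lt⟩
  have hsN : ¬ s ∣ p * q * r := by
    rw [hs.dvd_mul, hs.dvd_mul, Nat.prime_dvd_prime_iff_eq hs hp,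
      Nat.prime_dvd_prime_iff_eq hs hq, Nat.prime_dvd_prime_iff_eq hs hr]
    omega
  have hle := A_mul_prime_le hN hs hsN (cyclotomic_three_primes_mul hp hq hr
    hpq.ne (hpq.trans hqr).ne hqr.ne)
  have hψ : coeffL1 (cyclotomic (p * q) ℤ * (∑ i ∈ Finset.range p, (X ^ r) ^ i) *
      (X ^ (q * r) - X ^ 0)) ≤ p * (p * q) := by
    calc _ ≤ coeffL1 (cyclotomic (p * q) ℤ) * p * 2 := by
            refine (coeffL1_mul_le _ _).trans (Nat.mul_le_mul ?_ ?_)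
            · exact (coeffL1_mul_le _ _).trans
                (Nat.mul_le_mul_left _ (coeffL1_geom_sum_le _ _))
            · refine (coeffL1_sub_le _ _).trans ?_
              rw [coeffL1_X_pow, coeffL1_X_pow]
      _ = p * (2 * coeffL1 (cyclotomic (p * q) ℤ)) := by ring
      _ ≤ p * (p * q) :=
        Nat.mul_le_mul_left _ (two_mul_coeffL1_cyclotomic_two_primes_le hp hq hpq.ne)
  have hnat : A (p * q * r * s) ≤ A (p * q * r) * (p * (p * q)) :=
    hle.trans (Nat.mul_le_mul_left _ hψ)
  calc (A (p * q * r * s) : ℝ) ≤ A (p * q * r) * (p * (p * q)) := by exact_mod_cast hnat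
    _ ≤ ε * p * (p * (p * q)) :=
      mul_le_mul_of_nonneg_right (h3 p q r hp hq hr hop hoq hor hpq hqr) (by positivity)
    _ = ε * (p : ℝ) ^ 3 * q := by ring
end

section
/- For all odd primes p < q < r < s < t < u, the height of the cyclotomic polynomial Φ_{pqrstu} is at most (18225/262144)·p^{15}q^{7}r^{3}s. -/
open Polynomial

/-- The sum of the absolute values of the first `T` coefficients of an integer power series. -/
noncomputable def truncNorm (T : ℕ) (F : PowerSeries ℤ) : ℕ :=
  ∑ i ∈ Finset.range T, (PowerSeries.coeff i F).natAbs

/-- The sum of the absolute values of the coefficients of an integer polynomial. -/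
noncomputable def polyLength (f : ℤ[X]) : ℕ :=
  truncNorm (f.natDegree + 1) f

theorem truncNorm_mul_le (T : ℕ) (F G : PowerSeries ℤ) :
    truncNorm T (F * G) ≤ truncNorm T F * truncNorm T G := by
  calc truncNorm T (F * G)
      ≤ ∑ t ∈ Finset.range T, ∑ k ∈ Finset.range (t + 1),
          (PowerSeries.coeff k F).natAbs * (PowerSeries.coeff (t - k) G).natAbs := by
        refine Finset.sum_le_sum fun t _ => ?_
        rw [PowerSeries.coeff_mul, Finset.Nat.sum_antidiagonal_eq_sum_range_succ_mk]
        refine (Int.natAbs_sum_le _ _).trans_eq ?_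
        simp only [Int.natAbs_mul, Nat.succ_eq_add_one]
    _ = ∑ m ∈ Finset.range T, ∑ k ∈ Finset.range (T - m),
          (PowerSeries.coeff m F).natAbs * (PowerSeries.coeff k G).natAbs :=
        Finset.sum_range_diag_flip T
          fun a b => (PowerSeries.coeff a F).natAbs * (PowerSeries.coeff b G).natAbs
    _ ≤ ∑ m ∈ Finset.range T, ∑ k ∈ Finset.range T,
          (PowerSeries.coeff m F).natAbs * (PowerSeries.coeff k G).natAbs := by
        refine Finset.sum_le_sum fun m _ => Finset.sum_le_sum_of_subset ?_
        exact Finset.range_subset_range.2 (Nat.sub_le _ _)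
    _ = truncNorm T F * truncNorm T G := by
        simp only [truncNorm, Finset.sum_mul_sum]

theorem truncNorm_mono {S T : ℕ} (h : S ≤ T) (F : PowerSeries ℤ) :
    truncNorm S F ≤ truncNorm T F :=
  Finset.sum_le_sum_of_subset (Finset.range_subset_range.2 h)

theorem truncNorm_coe_of_natDegree_lt {T : ℕ} {f : ℤ[X]} (h : f.natDegree < T) :
    truncNorm T (f : PowerSeries ℤ) = polyLength f := by
  refine (Finset.sum_subset (Finset.range_subset_range.2 h) fun i _ hi => ?_).symm
  rw [coeff_coe, coeff_eq_zero_of_natDegree_lt (by simpa using hi), Int.natAbs_zero]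

theorem truncNorm_coe_le (T : ℕ) (f : ℤ[X]) :
    truncNorm T (f : PowerSeries ℤ) ≤ polyLength f := by
  rw [← truncNorm_coe_of_natDegree_lt (show f.natDegree < f.natDegree + 1 + T by omega)]
  exact truncNorm_mono (by omega) _

theorem polyLength_le_of_forall {f : ℤ[X]} {B : ℕ}
    (h : ∀ T, truncNorm T (f : PowerSeries ℤ) ≤ B) : polyLength f ≤ B := h _

theorem polyLength_mul_le (f g : ℤ[X]) :
    polyLength (f * g) ≤ polyLength f * polyLength g :=
  polyLength_le_of_forall fun T => by
    rw [coe_mul]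
    exact (truncNorm_mul_le T _ _).trans
      (Nat.mul_le_mul (truncNorm_coe_le T f) (truncNorm_coe_le T g))

theorem polyLength_add_le (f g : ℤ[X]) :
    polyLength (f + g) ≤ polyLength f + polyLength g :=
  polyLength_le_of_forall fun T => by
    refine le_trans ?_ (Nat.add_le_add (truncNorm_coe_le T f) (truncNorm_coe_le T g))
    simp only [truncNorm, ← Finset.sum_add_distrib, coeff_coe, coeff_add]
    exact Finset.sum_le_sum fun i _ => Int.natAbs_add_le _ _

theorem polyLength_neg (f : ℤ[X]) : polyLength (-f) = polyLength f := by
  simp [polyLength, truncNorm]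

theorem polyLength_sub_le (f g : ℤ[X]) :
    polyLength (f - g) ≤ polyLength f + polyLength g := by
  simpa only [sub_eq_add_neg, polyLength_neg] using polyLength_add_le f (-g)

theorem polyLength_X_pow (n : ℕ) : polyLength (X ^ n) = 1 := by
  simp [polyLength, truncNorm, apply_ite Int.natAbs]

theorem polyLength_sum_X_pow_le {ι : Type*} (s : Finset ι) (e : ι → ℕ) :
    polyLength (∑ i ∈ s, X ^ e i) ≤ s.card := by
  classical
  induction s using Finset.induction_on with
  | empty => simp [polyLength, truncNorm]
  | insert a s ha ih =>
    rw [Finset.sum_insert ha, Finset.card_insert_of_notMem ha]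
    have := polyLength_add_le (X ^ e a) (∑ i ∈ s, X ^ e i)
    rw [polyLength_X_pow] at this
    omega

theorem truncNorm_expand_le {p S T : ℕ} (hp : 0 < p) (f : ℤ[X])
    (h : ∀ i, i * p < T → i < S) :
    truncNorm T (expand ℤ p f : PowerSeries ℤ) ≤ truncNorm S (f : PowerSeries ℤ) := by
  have hsub : {t ∈ Finset.range T | p ∣ t} ⊆ (Finset.range S).image (· * p) := by
    intro t ht
    obtain ⟨ht, i, rfl⟩ := by simpa using ht
    exact Finset.mem_image.2 ⟨i, by simpa using h i (by rwa [mul_comm]), mul_comm _ _⟩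
  calc truncNorm T (expand ℤ p f : PowerSeries ℤ)
      = ∑ t ∈ Finset.range T with p ∣ t, (f.coeff (t / p)).natAbs := by
        simp only [truncNorm, coeff_coe, coeff_expand hp, apply_ite Int.natAbs, Int.natAbs_zero,
          Finset.sum_filter]
    _ ≤ ∑ t ∈ (Finset.range S).image (· * p), (f.coeff (t / p)).natAbs :=
        Finset.sum_le_sum_of_subset hsub
    _ = truncNorm S (f : PowerSeries ℤ) := by
        rw [Finset.sum_image fun a _ b _ hab => Nat.eq_of_mul_eq_mul_right hp hab]
        simp [truncNorm, Nat.mul_div_cancel _ hp]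

theorem polyLength_expand_le {p : ℕ} (hp : 0 < p) (f : ℤ[X]) :
    polyLength (expand ℤ p f) ≤ polyLength f :=
  polyLength_le_of_forall fun T =>
    (truncNorm_expand_le hp f fun i hi => (Nat.le_mul_of_pos_right i hp).trans_lt hi).trans
      (truncNorm_coe_le T f)

theorem natAbs_coeff_coe_mul_le {f : ℤ[X]} {K : PowerSeries ℤ} {B : ℕ}
    (hK : ∀ t, (PowerSeries.coeff t K).natAbs ≤ B) (n : ℕ) :
    (PowerSeries.coeff n ((f : PowerSeries ℤ) * K)).natAbs ≤ polyLength f * B := by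
  rw [PowerSeries.coeff_mul, Finset.Nat.sum_antidiagonal_eq_sum_range_succ_mk]
  refine (Int.natAbs_sum_le _ _).trans ?_
  calc _ ≤ ∑ k ∈ Finset.range n.succ, (PowerSeries.coeff k (f : PowerSeries ℤ)).natAbs * B :=
        Finset.sum_le_sum fun k _ => by
          rw [Int.natAbs_mul]
          exact Nat.mul_le_mul_left _ (hK _)
    _ ≤ polyLength f * B := by
        rw [← Finset.sum_mul]
        exact Nat.mul_le_mul_right _ (truncNorm_coe_le _ f)

/-- The power series `1 / (1 - X ^ m)`. -/
noncomputable def geomSeries (m : ℕ) : PowerSeries ℤ :=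
  PowerSeries.mk fun t => if m ∣ t then 1 else 0

theorem geomSeries_mul_one_sub {m : ℕ} (hm : 0 < m) :
    geomSeries m * (1 - PowerSeries.X ^ m) = 1 := by
  ext t
  rw [mul_sub, mul_one, map_sub, PowerSeries.coeff_mul_X_pow', PowerSeries.coeff_one]
  simp only [geomSeries, PowerSeries.coeff_mk]
  rcases lt_or_ge t m with h | h
  · rw [if_neg h.not_ge, sub_zero]
    exact if_congr ⟨fun hd => Nat.eq_zero_of_dvd_of_lt hd h, fun h0 => h0 ▸ dvd_zero m⟩ rfl rfl
  · rw [if_pos h, if_neg (by omega : t ≠ 0), sub_eq_zero]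
    refine if_congr ⟨fun hd => Nat.dvd_sub hd dvd_rfl, fun hd => ?_⟩ rfl rfl
    simpa [Nat.sub_add_cancel h] using Nat.dvd_add hd (dvd_refl m)

theorem truncNorm_geomSeries_le {m T c : ℕ} (h : T ≤ c * m) :
    truncNorm T (geomSeries m) ≤ c := by
  have hsub : {t ∈ Finset.range T | m ∣ t} ⊆ (Finset.range c).image (· * m) := by
    intro t ht
    obtain ⟨ht, i, rfl⟩ := by simpa using ht
    refine Finset.mem_image.2 ⟨i, ?_, mul_comm _ _⟩
    rw [Finset.mem_range]
    exact lt_of_mul_lt_mul_right (by rw [mul_comm]; omega) (Nat.zero_le m)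
  calc truncNorm T (geomSeries m) = {t ∈ Finset.range T | m ∣ t}.card := by
        simp only [truncNorm, geomSeries, PowerSeries.coeff_mk, apply_ite Int.natAbs,
          Int.natAbs_one, Int.natAbs_zero, Finset.card_filter]
    _ ≤ c := (Finset.card_le_card hsub).trans (Finset.card_image_le.trans (by simp))

theorem coeff_expand_mul_geomSeries {f : ℤ[X]} {m p : ℕ} (hp : 0 < p) (hpm : p.Coprime m)
    (hf : f.natDegree < m) (t : ℕ) :
    PowerSeries.coeff t ((expand ℤ p f : PowerSeries ℤ) * geomSeries m) = 0 ∨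
      ∃ i h, i * p + h * m = t ∧
        PowerSeries.coeff t ((expand ℤ p f : PowerSeries ℤ) * geomSeries m) = f.coeff i := by
  rw [PowerSeries.coeff_mul]
  have key : ∀ x : ℕ × ℕ,
      PowerSeries.coeff x.1 (expand ℤ p f : PowerSeries ℤ) *
        PowerSeries.coeff x.2 (geomSeries m) ≠ 0 →
      ∃ i h, x = (i * p, h * m) ∧ i < m ∧
      PowerSeries.coeff x.1 (expand ℤ p f : PowerSeries ℤ) *
        PowerSeries.coeff x.2 (geomSeries m) = f.coeff i := by
    rintro ⟨a, b⟩ hx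
    simp only [geomSeries, PowerSeries.coeff_mk, coeff_coe, coeff_expand hp] at hx ⊢
    obtain ⟨⟨h, rfl⟩, ⟨i, rfl⟩, hfa⟩ := by simpa using hx
    rw [Nat.mul_div_cancel_left _ hp] at hfa
    exact ⟨i, h, by simp [mul_comm], (le_natDegree_of_ne_zero hfa).trans_lt hf,
      by simp [Nat.mul_div_cancel_left _ hp]⟩
  by_cases hz : ∃ x ∈ Finset.HasAntidiagonal.antidiagonal t,
      PowerSeries.coeff x.1 (expand ℤ p f : PowerSeries ℤ) *
        PowerSeries.coeff x.2 (geomSeries m) ≠ 0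
  · obtain ⟨x, hxt, hx⟩ := hz
    obtain ⟨i, h, rfl, him, hval⟩ := key x hx
    refine Or.inr ⟨i, h, by simpa using hxt, ?_⟩
    rw [← hval]
    refine Finset.sum_eq_single _ (fun y hyt hyx => ?_) fun hn => absurd hxt hn
    by_contra hy
    obtain ⟨j, k, rfl, hjm, -⟩ := key y hy
    have e : i * p + h * m = j * p + k * m := by
      rw [Finset.HasAntidiagonal.mem_antidiagonal] at hxt hyt
      exact hxt.trans hyt.symm
    have hij : i * p ≡ j * p [MOD m] := by
      have : i * p + h * m ≡ j * p + k * m [MOD m] := congrArg (· % m) e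
      simpa [Nat.ModEq] using this
    have : i = j :=
      (Nat.ModEq.cancel_right_of_coprime hpm.symm hij).eq_of_lt_of_lt him hjm
    subst this
    exact hyx (by rw [Nat.add_left_cancel e])
  · push Not at hz
    exact Or.inl (Finset.sum_eq_zero hz)

theorem cyclotomic_reverse {n : ℕ} (hn : 1 < n) :
    (cyclotomic n ℤ).reverse = cyclotomic n ℤ := by
  induction n using Nat.strong_induction_on with
  | _ n ih =>
    have hX : ∀ k : ℕ, 0 < k → (X ^ k - 1 : ℤ[X]).reverse = -(X ^ k - 1) := by
      intro k hk
      have hdeg : (X ^ k - 1 : ℤ[X]).natDegree = k := by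
        simpa using natDegree_X_pow_sub_C (R := ℤ) (n := k) (r := 1)
      rw [reverse, hdeg, reflect_sub, reflect_one, neg_sub]
      simp [reflect_monomial]
    let rev : ℤ[X] →* ℤ[X] :=
      { toFun := reverse
        map_one' := by simpa using reverse_C (1 : ℤ)
        map_mul' := reverse_mul_of_domain }
    have h1 : 1 ∈ n.properDivisors := Nat.one_mem_properDivisors_iff_one_lt.2 hn
    set Q : ℤ[X] := ∏ d ∈ n.properDivisors.erase 1, cyclotomic d ℤ with hQ
    have hprod : cyclotomic n ℤ * ((X - 1) * Q) = X ^ n - 1 := by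
      rw [← prod_cyclotomic_eq_X_pow_sub_one (by omega : 0 < n) ℤ,
        ← Nat.cons_self_properDivisors (by omega : n ≠ 0), Finset.prod_cons,
        ← Finset.mul_prod_erase _ _ h1, cyclotomic_one]
    have hrevQ : Q.reverse = Q := by
      change rev Q = Q
      rw [hQ, map_prod]
      refine Finset.prod_congr rfl fun d hd => ?_
      obtain ⟨hd1, hd⟩ := Finset.mem_erase.1 hd
      have hpos := Nat.pos_of_mem_properDivisors hd
      exact ih d (Nat.mem_properDivisors.1 hd).2 (by omega)
    have hrev := congrArg reverse hprod
    rw [reverse_mul_of_domain, reverse_mul_of_domain, hrevQ, hX n (by omega), ← hprod] at hrev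
    have h1' := hX 1 one_pos
    rw [pow_one] at h1'
    rw [h1', ← mul_neg, neg_mul] at hrev
    have hne : -((X - 1) * Q) ≠ 0 := by
      intro h0
      rw [neg_eq_zero] at h0
      rw [h0, mul_zero] at hprod
      exact X_pow_sub_C_ne_zero (by omega : 0 < n) (1 : ℤ) (by simpa using hprod.symm)
    exact mul_right_cancel₀ hne hrev

theorem polyLength_of_reverse_eq {f : ℤ[X]} {d : ℕ} (hf : f.reverse = f)
    (hd : f.natDegree = 2 * d) :
    polyLength f = truncNorm d (f : PowerSeries ℤ) + truncNorm (d + 1) (f : PowerSeries ℤ) := by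
  rw [polyLength, hd, show 2 * d + 1 = d + (d + 1) by ring, truncNorm, Finset.sum_range_add,
    truncNorm, truncNorm, ← Finset.sum_range_reflect _ (d + 1)]
  refine congrArg _ (Finset.sum_congr rfl fun x hx => ?_)
  rw [Finset.mem_range] at hx
  rw [coeff_coe, coeff_coe, ← hf, coeff_reverse, hf, hd, revAt_le (by omega),
    show 2 * d - (d + (d + 1 - 1 - x)) = x by omega]

theorem natAbs_coeff_cyclotomic_le (n i : ℕ) : ((cyclotomic n ℤ).coeff i).natAbs ≤ A n := by
  by_cases h : i ∈ (cyclotomic n ℤ).support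
  · exact Finset.le_sup (f := fun m => ((cyclotomic n ℤ).coeff m).natAbs) h
  · simp [notMem_support_iff.1 h]

theorem A_le_of_forall {n B : ℕ} (h : ∀ i, ((cyclotomic n ℤ).coeff i).natAbs ≤ B) : A n ≤ B :=
  Finset.sup_le fun i _ => h i

section InverseCyclotomic

variable {m P : ℕ} {G : ℤ[X]}

theorem coe_cyclotomic_mul_prime (hm : 0 < m) (hP : P.Prime) (hd : ¬P ∣ m)
    (hG : G * cyclotomic m ℤ = 1 - X ^ m) :
    (cyclotomic (m * P) ℤ : PowerSeries ℤ) =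
      G * ((expand ℤ P (cyclotomic m ℤ) : PowerSeries ℤ) * geomSeries m) := by
  have h : cyclotomic (m * P) ℤ * (1 - X ^ m) = G * expand ℤ P (cyclotomic m ℤ) := by
    rw [cyclotomic_expand_eq_cyclotomic_mul hP hd, ← hG]
    ring
  have h' := congrArg (fun f : ℤ[X] => (f : PowerSeries ℤ) * geomSeries m) h
  simp only [coe_mul, coe_sub, coe_one, coe_pow, coe_X] at h'
  rw [mul_assoc, mul_comm (1 - _) (geomSeries m), geomSeries_mul_one_sub hm, mul_one] at h'
  rw [h', mul_assoc]

theorem A_mul_prime_le_s11 (hm : 1 < m) (hP : P.Prime) (hd : ¬P ∣ m)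
    (hG : G * cyclotomic m ℤ = 1 - X ^ m) : A (m * P) ≤ polyLength G * A m := by
  refine A_le_of_forall fun i => ?_
  rw [← coeff_coe, coe_cyclotomic_mul_prime (by omega) hP hd hG]
  refine natAbs_coeff_coe_mul_le (fun t => ?_) i
  have hdeg : (cyclotomic m ℤ).natDegree < m := by
    rw [natDegree_cyclotomic]
    exact Nat.totient_lt m hm
  rcases coeff_expand_mul_geomSeries hP.pos ((Nat.Prime.coprime_iff_not_dvd hP).2 hd) hdeg t
    with h | ⟨j, -, -, h⟩
  · simp [h]
  · rw [h]
    exact natAbs_coeff_cyclotomic_le m j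

theorem two_mul_polyLength_cyclotomic_le (hm : 2 < m) (hP : P.Prime) (hodd : Odd P)
    (hd : ¬P ∣ m) (hG : G * cyclotomic m ℤ = 1 - X ^ m) :
    2 * polyLength (cyclotomic (m * P) ℤ) ≤
      polyLength G * polyLength (cyclotomic m ℤ) * P := by
  obtain ⟨c, rfl⟩ := hodd
  obtain ⟨k, hk⟩ := Nat.totient_even hm
  have hlt : m.totient < m := Nat.totient_lt m (by omega)
  have hpos : 0 < m.totient := Nat.totient_pos.2 (by omega)
  have hc : 0 < c := by
    rcases Nat.eq_zero_or_pos c with rfl | h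
    · exact absurd hP (by norm_num)
    · exact h
  have hcop : m.Coprime (2 * c + 1) := ((Nat.Prime.coprime_iff_not_dvd hP).2 hd).symm
  have hdegm : (cyclotomic m ℤ).natDegree = 2 * k := by
    rw [natDegree_cyclotomic]
    omega
  have hdegP : (cyclotomic (m * (2 * c + 1)) ℤ).natDegree = 2 * (m.totient * c) := by
    rw [natDegree_cyclotomic, Nat.totient_mul hcop, Nat.totient_prime hP]
    simp
    ring
  have hupper := polyLength_of_reverse_eq (cyclotomic_reverse (by nlinarith)) hdegP
  have hlower := polyLength_of_reverse_eq (cyclotomic_reverse (by omega)) hdegm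
  set T := m.totient * c + 1 with hT
  have h1 : polyLength (cyclotomic (m * (2 * c + 1)) ℤ) ≤
      2 * truncNorm T (cyclotomic (m * (2 * c + 1)) ℤ : PowerSeries ℤ) := by
    have := truncNorm_mono (show m.totient * c ≤ T by omega)
      (cyclotomic (m * (2 * c + 1)) ℤ : PowerSeries ℤ)
    omega
  have h2 : 2 * truncNorm k (cyclotomic m ℤ : PowerSeries ℤ) ≤ polyLength (cyclotomic m ℤ) := by
    have := truncNorm_mono (show k ≤ k + 1 by omega) (cyclotomic m ℤ : PowerSeries ℤ)
    omega
  have h3 : truncNorm T (expand ℤ (2 * c + 1) (cyclotomic m ℤ) : PowerSeries ℤ) ≤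
      truncNorm k (cyclotomic m ℤ : PowerSeries ℤ) := by
    refine truncNorm_expand_le hP.pos _ fun i hi => ?_
    by_contra! hki
    rw [hT, hk] at hi
    nlinarith
  have h4 : truncNorm T (geomSeries m) ≤ c := truncNorm_geomSeries_le (by nlinarith)
  have h5 : truncNorm T (cyclotomic (m * (2 * c + 1)) ℤ : PowerSeries ℤ) ≤
      polyLength G * (truncNorm k (cyclotomic m ℤ : PowerSeries ℤ) * c) := by
    rw [coe_cyclotomic_mul_prime (by omega) hP hd hG]
    exact (truncNorm_mul_le _ _ _).trans (Nat.mul_le_mul (truncNorm_coe_le _ _)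
      ((truncNorm_mul_le _ _ _).trans (Nat.mul_le_mul h3 h4)))
  calc 2 * polyLength (cyclotomic (m * (2 * c + 1)) ℤ)
      ≤ 2 * (2 * (polyLength G * (truncNorm k (cyclotomic m ℤ : PowerSeries ℤ) * c))) := by
        omega
    _ = polyLength G * (2 * truncNorm k (cyclotomic m ℤ : PowerSeries ℤ)) * (2 * c) := by ring
    _ ≤ polyLength G * polyLength (cyclotomic m ℤ) * (2 * c + 1) := by
        gcongr
        omega

theorem exists_inverse_cyclotomic_mul_prime (hP : P.Prime) (hd : ¬P ∣ m)
    (hG : G * cyclotomic m ℤ = 1 - X ^ m) :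
    ∃ G' : ℤ[X], G' * cyclotomic (m * P) ℤ = 1 - X ^ (m * P) ∧
      polyLength G' ≤ polyLength G * polyLength (cyclotomic m ℤ) := by
  refine ⟨expand ℤ P G * cyclotomic m ℤ, ?_, (polyLength_mul_le _ _).trans
    (Nat.mul_le_mul_right _ (polyLength_expand_le hP.pos G))⟩
  rw [mul_assoc, mul_comm (cyclotomic m ℤ), ← cyclotomic_expand_eq_cyclotomic_mul hP hd,
    ← map_mul, hG]
  simp [← pow_mul, mul_comm]

end InverseCyclotomic

section TwoPrimes

variable {p q : ℕ}

theorem polyLength_cyclotomic_prime_le (hp : p.Prime) : polyLength (cyclotomic p ℤ) ≤ p := by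
  have := Fact.mk hp
  rw [cyclotomic_prime]
  simpa using polyLength_sum_X_pow_le (Finset.range p) id

theorem one_sub_X_mul_cyclotomic_prime (hp : p.Prime) :
    (1 - X) * cyclotomic p ℤ = 1 - X ^ p := by
  have := Fact.mk hp
  linear_combination -cyclotomic_prime_mul_X_sub_one ℤ p

theorem one_sub_X_pow_mul_cyclotomic_prime (hp : p.Prime) (hq : q.Prime) (hpq : p ≠ q) :
    ((1 - X ^ q) * cyclotomic p ℤ) * cyclotomic (p * q) ℤ = 1 - X ^ (p * q) := by
  have hd : ¬q ∣ p := fun h => hpq ((Nat.prime_dvd_prime_iff_eq hq hp).1 h).symm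
  have h := congrArg (expand ℤ q) (one_sub_X_mul_cyclotomic_prime hp)
  rw [map_mul, cyclotomic_expand_eq_cyclotomic_mul hq hd] at h
  simp only [map_sub, map_one, map_pow, expand_X, ← pow_mul, mul_comm q p] at h
  rw [← h]
  ring

theorem exists_mul_add_mul_eq (hp : p.Prime) (hq : q.Prime) (hpq : p ≠ q) :
    ∃ a b : ℕ, a ≤ q ∧ b ≤ p ∧ a * p + b * q = p * q + 1 := by
  obtain ⟨b, hb, hbq⟩ :=
    Nat.exists_mul_mod_eq_one_of_coprime ((Nat.coprime_primes hq hp).2 hpq.symm) hp.one_lt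
  have h := Nat.div_add_mod (q * b) p
  rw [hbq] at h
  have hle : q * b / p ≤ q :=
    Nat.div_le_of_le_mul (by rw [mul_comm p]; exact Nat.mul_le_mul_left q hb.le)
  refine ⟨q - q * b / p, b, Nat.sub_le _ _, hb.le, ?_⟩
  obtain ⟨c, hc⟩ := Nat.exists_eq_add_of_le hle
  generalize q * b / p = k at h hc
  rw [show q - k = c by omega, mul_comm b q, ← h, hc]
  ring

theorem cyclotomic_prime_mul_prime_eq (hp : p.Prime) (hq : q.Prime) (hpq : p ≠ q)
    {a b a' b' : ℕ} (ha : a + a' = q) (hb : b + b' = p) (h : a * p + b * q = p * q + 1) :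
    cyclotomic (p * q) ℤ =
      (∑ i ∈ Finset.range a, X ^ (p * i)) * (∑ j ∈ Finset.range b, X ^ (q * j)) -
        X * ((∑ i ∈ Finset.range a', X ^ (p * i)) * ∑ j ∈ Finset.range b', X ^ (q * j)) := by
  have hgeom (k n : ℕ) : (∑ i ∈ Finset.range n, (X : ℤ[X]) ^ (k * i)) * (1 - X ^ k) =
      1 - X ^ (k * n) := by
    simpa only [← pow_mul] using geom_sum_mul_neg ((X : ℤ[X]) ^ k) n
  have hne : ∀ k : ℕ, k.Prime → (1 - X ^ k : ℤ[X]) ≠ 0 := by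
    intro k hk h0
    exact X_pow_sub_C_ne_zero hk.pos (1 : ℤ) (by simpa using (neg_eq_zero.2 h0))
  refine mul_right_cancel₀ (mul_ne_zero (hne p hp) (hne q hq)) ?_
  have hΦ := one_sub_X_pow_mul_cyclotomic_prime hp hq hpq
  have hΦp := one_sub_X_mul_cyclotomic_prime hp
  have e1 : (X : ℤ[X]) * X ^ (p * a') = X ^ (q * b) := by
    rw [← pow_succ']
    congr 1
    subst ha
    nlinarith
  have e2 : (X : ℤ[X]) * X ^ (q * b') = X ^ (p * a) := by
    rw [← pow_succ']
    congr 1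
    subst hb
    nlinarith
  have e3 : (X : ℤ[X]) ^ (p * a) * X ^ (q * b) = X * X ^ (p * q) := by
    rw [← pow_succ', ← pow_add, mul_comm p a, mul_comm q b, h]
  have e4 : (X : ℤ[X]) ^ (q * b) * X ^ (q * b') = X ^ (p * q) := by
    rw [← pow_add, ← mul_add, hb, mul_comm]
  calc cyclotomic (p * q) ℤ * ((1 - X ^ p) * (1 - X ^ q))
      = (1 - X) * (1 - X ^ (p * q)) := by rw [← hΦ, ← hΦp]; ring
    _ = (1 - X ^ (p * a)) * (1 - X ^ (q * b)) -
          X * ((1 - X ^ (p * a')) * (1 - X ^ (q * b'))) := by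
        linear_combination -e3 + e4 - e2 + X ^ (q * b') * e1 - e1
    _ = _ := by rw [← hgeom p a, ← hgeom q b, ← hgeom p a', ← hgeom q b']; ring

theorem two_mul_polyLength_cyclotomic_prime_mul_prime_le (hp : p.Prime) (hq : q.Prime)
    (hpq : p ≠ q) : 2 * polyLength (cyclotomic (p * q) ℤ) ≤ p * q := by
  obtain ⟨a, b, ha, hb, h⟩ := exists_mul_add_mul_eq hp hq hpq
  obtain ⟨a', ha'⟩ := Nat.exists_eq_add_of_le ha
  obtain ⟨b', hb'⟩ := Nat.exists_eq_add_of_le hb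
  have hS (k n : ℕ) : polyLength (∑ i ∈ Finset.range n, X ^ (k * i)) ≤ n := by
    simpa using polyLength_sum_X_pow_le (Finset.range n) (k * ·)
  have hX : polyLength (X : ℤ[X]) = 1 := by simpa using polyLength_X_pow 1
  have hlen : polyLength (cyclotomic (p * q) ℤ) ≤ a * b + a' * b' := by
    rw [cyclotomic_prime_mul_prime_eq hp hq hpq ha'.symm hb'.symm h]
    refine (polyLength_sub_le _ _).trans (Nat.add_le_add ?_ ?_)
    · exact (polyLength_mul_le _ _).trans (Nat.mul_le_mul (hS _ _) (hS _ _))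
    · refine (polyLength_mul_le _ _).trans ?_
      rw [hX, one_mul]
      exact (polyLength_mul_le _ _).trans (Nat.mul_le_mul (hS _ _) (hS _ _))
  have h1 : a * b = a' * b' + 1 := by
    subst ha' hb'
    nlinarith
  have h2 : 4 * (a * b) * (p * q) ≤ (p * q + 1) ^ 2 := by
    rw [← h]
    nlinarith [four_mul_le_sq_add (a * p) (b * q)]
  have hpq1 : 1 < p * q := by nlinarith [hp.two_le, hq.two_le]
  by_contra! hcon
  have h3 : p * q + 3 ≤ 4 * (a * b) := by omega
  nlinarith

end TwoPrimes

section Ternary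

variable {p q r : ℕ}

theorem coeff_cyclotomic_prime_mem (hp : p.Prime) (i : ℕ) :
    0 ≤ (cyclotomic p ℤ).coeff i ∧ (cyclotomic p ℤ).coeff i ≤ 1 := by
  have := Fact.mk hp
  rw [cyclotomic_prime, finsetSum_coeff]
  simp only [coeff_X_pow, Finset.sum_ite_eq]
  split_ifs <;> simp

theorem natAbs_coeff_cyclotomic_prime_mul_prime_sub_le (hp : p.Prime) (hq : q.Prime)
    (hpq : p ≠ q) (i k : ℕ) :
    ((cyclotomic (p * q) ℤ).coeff i).natAbs ≤ 1 ∧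
      ((cyclotomic (p * q) ℤ).coeff (i + k * q) - (cyclotomic (p * q) ℤ).coeff i).natAbs ≤ 1 := by
  have hd : ¬p ∣ q := fun h => hpq ((Nat.prime_dvd_prime_iff_eq hp hq).1 h)
  have hcop : p.Coprime q := (Nat.coprime_primes hp hq).2 hpq
  have hdeg : (cyclotomic q ℤ).natDegree < q := by
    rw [natDegree_cyclotomic]
    exact Nat.totient_lt q hq.one_lt
  set E : ℤ[X] := expand ℤ p (cyclotomic q ℤ) with hE
  set K : PowerSeries ℤ := (E : PowerSeries ℤ) * geomSeries q with hK
  have hΦ : (cyclotomic (p * q) ℤ : PowerSeries ℤ) = (1 - PowerSeries.X) * K := by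
    rw [mul_comm p q, coe_cyclotomic_mul_prime hq.pos hp hd (one_sub_X_mul_cyclotomic_prime hq)]
    simp [hK, hE]
  have hmem (t : ℕ) : 0 ≤ PowerSeries.coeff t K ∧ PowerSeries.coeff t K ≤ 1 := by
    rcases coeff_expand_mul_geomSeries hp.pos hcop hdeg t with h | ⟨j, -, -, h⟩
    · rw [hK, h]
      norm_num
    · rw [hK, h]
      exact coeff_cyclotomic_prime_mem hq j
  have hmono (t k : ℕ) : PowerSeries.coeff t K ≤ PowerSeries.coeff (t + k * q) K := by
    induction k with
    | zero => simp
    | succ k ih =>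
      refine ih.trans ?_
      have h : K * (1 - PowerSeries.X ^ q) = (E : PowerSeries ℤ) := by
        rw [hK, mul_assoc, geomSeries_mul_one_sub hq.pos, mul_one]
      have h' := congrArg (PowerSeries.coeff (t + (k + 1) * q)) h
      rw [mul_sub, mul_one, map_sub, PowerSeries.coeff_mul_X_pow', if_pos (by nlinarith),
        show t + (k + 1) * q - q = t + k * q by rw [Nat.succ_mul]; omega, coeff_coe, hE,
        coeff_expand hp.pos] at h'
      have hnonneg := (coeff_cyclotomic_prime_mem hq ((t + (k + 1) * q) / p)).1
      split_ifs at h' <;> linarith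
  have hcoeff (t : ℕ) : (cyclotomic (p * q) ℤ).coeff t =
      PowerSeries.coeff t K - PowerSeries.coeff t (PowerSeries.X * K) := by
    rw [← coeff_coe, hΦ, sub_mul, one_mul, map_sub]
  rw [hcoeff, hcoeff]
  have h1 := hmem i
  have h2 := hmem (i + k * q)
  have h3 := hmono i k
  rcases i with _ | i
  · rw [PowerSeries.coeff_zero_X_mul]
    rcases hj : 0 + k * q with _ | j
    · rw [PowerSeries.coeff_zero_X_mul]
      omega
    · rw [PowerSeries.coeff_succ_X_mul, ← hj]
      have h4 := hmem j
      omega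
  · have h4 := hmem i
    have h5 := hmem (i + k * q)
    have h6 := hmono i k
    rw [show i + 1 + k * q = i + k * q + 1 by ring] at h2 h3 ⊢
    rw [PowerSeries.coeff_succ_X_mul, PowerSeries.coeff_succ_X_mul]
    omega

theorem natAbs_sub_coeff_le_of_modEq (hp : p.Prime) (hq : q.Prime) (hpq : p ≠ q) {i j : ℕ}
    (h : i ≡ j [MOD q]) :
    ((cyclotomic (p * q) ℤ).coeff i - (cyclotomic (p * q) ℤ).coeff j).natAbs ≤ 1 := by
  wlog hij : j ≤ i generalizing i j
  · rw [← Int.natAbs_neg, neg_sub]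
    exact this h.symm (by omega)
  obtain ⟨k, hk⟩ := (Nat.modEq_iff_dvd' hij).1 h.symm
  rw [show i = j + k * q by rw [mul_comm]; omega]
  exact (natAbs_coeff_cyclotomic_prime_mul_prime_sub_le hp hq hpq j k).2

theorem A_mul_mul_prime_le (hp : p.Prime) (hq : q.Prime) (hr : r.Prime) (hpq : p ≠ q)
    (hpr : p ≠ r) (hqr : q ≠ r) : A (p * q * r) ≤ p := by
  have hcoppq : r.Coprime (p * q) :=
    Nat.Coprime.mul_right ((Nat.coprime_primes hr hp).2 hpr.symm)
      ((Nat.coprime_primes hr hq).2 hqr.symm)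
  have hd : ¬r ∣ p * q := (Nat.Prime.coprime_iff_not_dvd hr).1 hcoppq
  have hpos : 0 < p * q := Nat.mul_pos hp.pos hq.pos
  have hlt : 1 < p * q := by nlinarith [hp.two_le, hq.two_le]
  have hdeg : (cyclotomic (p * q) ℤ).natDegree < p * q := by
    rw [natDegree_cyclotomic]
    exact Nat.totient_lt _ hlt
  set K : PowerSeries ℤ :=
    (expand ℤ r (cyclotomic (p * q) ℤ) : PowerSeries ℤ) * geomSeries (p * q) with hK
  have hcases := coeff_expand_mul_geomSeries hr.pos hcoppq hdeg
  have hle (i : ℕ) : ((cyclotomic (p * q) ℤ).coeff i).natAbs ≤ 1 :=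
    (natAbs_coeff_cyclotomic_prime_mul_prime_sub_le hp hq hpq i 0).1
  have hKle (t : ℕ) : (PowerSeries.coeff t K).natAbs ≤ 1 := by
    rcases hcases t with h | ⟨j, -, -, h⟩
    · simp [hK, h]
    · rw [hK, h]
      exact hle j
  have hL (t : ℕ) : (PowerSeries.coeff t ((1 - PowerSeries.X ^ q) * K)).natAbs ≤ 1 := by
    rw [sub_mul, one_mul, map_sub, PowerSeries.coeff_X_pow_mul']
    split_ifs with htq
    · rcases hcases t with h | ⟨i, a, hi, h⟩
      · rw [hK, h, zero_sub, Int.natAbs_neg]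
        exact hKle _
      · rcases hcases (t - q) with h' | ⟨j, b, hj, h'⟩
        · rw [hK, h', sub_zero]
          exact hKle _
        · rw [hK, h, h']
          refine natAbs_sub_coeff_le_of_modEq hp hq hpq ?_
          refine Nat.ModEq.cancel_right_of_coprime ((Nat.coprime_primes hq hr).2 hqr) (c := r) ?_
          have e : i * r + a * p * q = j * r + (b * p + 1) * q := by
            rw [← mul_assoc] at hi hj
            rw [add_mul, one_mul]
            omega
          have : i * r + a * p * q ≡ j * r + (b * p + 1) * q [MOD q] := congrArg (· % q) e
          simpa [Nat.ModEq] using this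
    · rw [sub_zero]
      exact hKle t
  refine A_le_of_forall fun i => ?_
  rw [← coeff_coe, coe_cyclotomic_mul_prime hpos hr hd
    (one_sub_X_pow_mul_cyclotomic_prime hp hq hpq), mul_comm (1 - X ^ q), coe_mul, mul_assoc]
  have h := natAbs_coeff_coe_mul_le (f := cyclotomic p ℤ) hL i
  rw [mul_one] at h
  simpa [hK] using h.trans (polyLength_cyclotomic_prime_le hp)

end Ternary

/-- **(Bzdęga, bound (5)).** For odd primes `p < q < r < s < t < u`,
`A (pqrstu) ≤ (18225/262144)·p¹⁵q⁷r³s`. -/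
theorem height_cyclotomic_stmt11 (p q r s t u : ℕ)
    (hp : p.Prime) (hq : q.Prime) (hr : r.Prime) (hs : s.Prime) (ht : t.Prime) (hu : u.Prime)
    (hop : Odd p) (hoq : Odd q) (hor : Odd r) (hos : Odd s) (hot : Odd t) (hou : Odd u)
    (hpq : p < q) (hqr : q < r) (hrs : r < s) (hst : s < t) (htu : t < u) :
    (A (p * q * r * s * t * u) : ℝ) ≤
      (18225 / 262144) * (p : ℝ) ^ 15 * (q : ℝ) ^ 7 * (r : ℝ) ^ 3 * s := by
  have hpq' : p ≠ q := by omega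
  have p3 : 3 ≤ p := by
    have := hp.two_le
    obtain ⟨k, rfl⟩ := hop
    omega
  have hdvd {m P : ℕ} (hP : P.Prime) (h : ¬P ∣ m) {x : ℕ} (hx : x.Prime) (hne : x < P) :
      ¬P ∣ m * x := by
    rw [hP.dvd_mul, Nat.prime_dvd_prime_iff_eq hP hx]
    omega
  have hdp {P : ℕ} (hP : P.Prime) (h : p < P) : ¬P ∣ p := by
    rw [Nat.prime_dvd_prime_iff_eq hP hp]
    omega
  have d3 : ¬r ∣ p * q := hdvd hr (hdp hr (by omega)) hq (by omega)
  have d4 : ¬s ∣ p * q * r :=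
    hdvd hs (hdvd hs (hdp hs (by omega)) hq (by omega)) hr (by omega)
  have d5 : ¬t ∣ p * q * r * s :=
    hdvd ht (hdvd ht (hdvd ht (hdp ht (by omega)) hq (by omega)) hr (by omega)) hs (by omega)
  have d6 : ¬u ∣ p * q * r * s * t :=
    hdvd hu (hdvd hu (hdvd hu (hdvd hu (hdp hu (by omega)) hq (by omega)) hr (by omega)) hs
      (by omega)) ht (by omega)
  have m2 : 2 < p * q := by nlinarith
  have m3 : 2 < p * q * r := by nlinarith
  have m4 : 2 < p * q * r * s := by nlinarith
  have m5 : 2 < p * q * r * s * t := by nlinarith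
  have hG2 := one_sub_X_pow_mul_cyclotomic_prime hp hq hpq'
  have lG2 : polyLength ((1 - X ^ q) * cyclotomic p ℤ) ≤ 2 * p := by
    refine (polyLength_mul_le _ _).trans
      (Nat.mul_le_mul ?_ (polyLength_cyclotomic_prime_le hp))
    refine (polyLength_sub_le _ _).trans ?_
    rw [polyLength_X_pow, ← pow_zero X, polyLength_X_pow]
  obtain ⟨G3, hG3, lG3⟩ := exists_inverse_cyclotomic_mul_prime hr d3 hG2
  obtain ⟨G4, hG4, lG4⟩ := exists_inverse_cyclotomic_mul_prime hs d4 hG3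
  obtain ⟨G5, hG5, lG5⟩ := exists_inverse_cyclotomic_mul_prime ht d5 hG4
  have S2 := two_mul_polyLength_cyclotomic_prime_mul_prime_le hp hq hpq'
  have S3 := two_mul_polyLength_cyclotomic_le m2 hr hor d3 hG2
  have S4 := two_mul_polyLength_cyclotomic_le m3 hs hos d4 hG3
  have A3 := A_mul_mul_prime_le hp hq hr hpq' (by omega) (by omega)
  have A4 := A_mul_prime_le_s11 (by omega) hs d4 hG3
  have A5 := A_mul_prime_le_s11 (by omega) ht d5 hG4
  have A6 := A_mul_prime_le_s11 (by omega) hu d6 hG5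
  set L2 := polyLength (cyclotomic (p * q) ℤ)
  set L3 := polyLength (cyclotomic (p * q * r) ℤ)
  set L4 := polyLength (cyclotomic (p * q * r * s) ℤ)
  have g3 : polyLength G3 ≤ p ^ 2 * q :=
    calc _ ≤ 2 * p * L2 := lG3.trans (Nat.mul_le_mul_right _ lG2)
      _ = p * (2 * L2) := by ring
      _ ≤ p * (p * q) := by gcongr
      _ = p ^ 2 * q := by ring
  have l3 : 2 * L3 ≤ p ^ 2 * q * r :=
    calc 2 * L3 ≤ 2 * p * L2 * r := S3.trans (by gcongr)
      _ = p * (2 * L2) * r := by ring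
      _ ≤ p * (p * q) * r := by gcongr
      _ = p ^ 2 * q * r := by ring
  have g4 : 2 * polyLength G4 ≤ p ^ 4 * q ^ 2 * r :=
    calc _ ≤ 2 * (p ^ 2 * q * L3) := by
          gcongr
          exact lG4.trans (Nat.mul_le_mul_right _ g3)
      _ = p ^ 2 * q * (2 * L3) := by ring
      _ ≤ p ^ 2 * q * (p ^ 2 * q * r) := by gcongr
      _ = p ^ 4 * q ^ 2 * r := by ring
  have l4 : 4 * L4 ≤ p ^ 4 * q ^ 2 * r * s :=
    calc 4 * L4 = 2 * (2 * L4) := by ring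
      _ ≤ 2 * (p ^ 2 * q * L3 * s) := by
          refine Nat.mul_le_mul_left 2 (S4.trans ?_)
          gcongr
      _ = p ^ 2 * q * (2 * L3) * s := by ring
      _ ≤ p ^ 2 * q * (p ^ 2 * q * r) * s := by gcongr
      _ = p ^ 4 * q ^ 2 * r * s := by ring
  have g5 : 8 * polyLength G5 ≤ p ^ 8 * q ^ 4 * r ^ 2 * s :=
    calc _ ≤ 8 * (polyLength G4 * L4) := by gcongr
      _ = (2 * polyLength G4) * (4 * L4) := by ring
      _ ≤ (p ^ 4 * q ^ 2 * r) * (p ^ 4 * q ^ 2 * r * s) := by gcongr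
      _ = p ^ 8 * q ^ 4 * r ^ 2 * s := by ring
  have key : 16 * A (p * q * r * s * t * u) ≤ p ^ 15 * q ^ 7 * r ^ 3 * s :=
    calc _ ≤ 16 * (polyLength G5 * (polyLength G4 * (polyLength G3 * p))) := by
          gcongr
          refine A6.trans (Nat.mul_le_mul_left _ (A5.trans (Nat.mul_le_mul_left _ ?_)))
          exact A4.trans (Nat.mul_le_mul_left _ A3)
      _ = (8 * polyLength G5) * ((2 * polyLength G4) * (polyLength G3 * p)) := by ring
      _ ≤ (p ^ 8 * q ^ 4 * r ^ 2 * s) * ((p ^ 4 * q ^ 2 * r) * (p ^ 2 * q * p)) := by gcongr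
      _ = p ^ 15 * q ^ 7 * r ^ 3 * s := by ring
  have key' : 16 * (A (p * q * r * s * t * u) : ℝ) ≤
      (p : ℝ) ^ 15 * (q : ℝ) ^ 7 * (r : ℝ) ^ 3 * s := by
    exact_mod_cast key
  have hnonneg : 0 ≤ (p : ℝ) ^ 15 * (q : ℝ) ^ 7 * (r : ℝ) ^ 3 * s := by positivity
  linarith
end

section
/- For all odd primes p < q < r < s < t, C_{pqrst} ≤ (9/16)·p⁷q³r, where C_n denotes the height of the polynomial (X^n − 1)/Φ_n(X). -/
open Polynomial

/-- `C n` is the height of the polynomial `(X^n - 1) / Φ_n(X)` (exact division,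
realized via division by the monic polynomial `Φ_n`). -/
noncomputable def Cinv (n : ℕ) : ℕ := polyHeight ((X ^ n - 1) /ₘ cyclotomic n ℤ)

/-- The sum of the absolute values of the coefficients of `f` with index satisfying `S`. -/
def coeffMass (S : ℕ → Prop) [DecidablePred S] (f : ℤ[X]) : ℤ :=
  f.sum fun l a => if S l then |a| else 0

section coeffMass

variable (S : ℕ → Prop) [DecidablePred S]

theorem coeffMass_eq_sum_range {f : ℤ[X]} {M : ℕ} (h : f.natDegree < M) :
    coeffMass S f = ∑ l ∈ Finset.range M, if S l then |f.coeff l| else 0 :=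
  Polynomial.sum_over_range' _ (by simp) _ h

theorem coeffMass_zero : coeffMass S 0 = 0 := by simp [coeffMass]

theorem coeffMass_nonneg (f : ℤ[X]) : 0 ≤ coeffMass S f :=
  Finset.sum_nonneg fun _ _ => by positivity

theorem coeffMass_add_le (f g : ℤ[X]) :
    coeffMass S (f + g) ≤ coeffMass S f + coeffMass S g := by
  have hf : f.natDegree < max f.natDegree g.natDegree + 1 := by omega
  have hg : g.natDegree < max f.natDegree g.natDegree + 1 := by omega
  rw [coeffMass_eq_sum_range S hf, coeffMass_eq_sum_range S hg,
    coeffMass_eq_sum_range S (Nat.lt_succ_of_le (natDegree_add_le f g)),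
    ← Finset.sum_add_distrib]
  refine Finset.sum_le_sum fun l _ => ?_
  split_ifs
  · simpa using abs_add_le (f.coeff l) (g.coeff l)
  · simp

theorem coeffMass_sum_le {ι : Type*} (s : Finset ι) (f : ι → ℤ[X]) :
    coeffMass S (∑ i ∈ s, f i) ≤ ∑ i ∈ s, coeffMass S (f i) :=
  Finset.le_sum_of_subadditive _ (coeffMass_zero S).le (coeffMass_add_le S) _ _

theorem coeffMass_monomial (n : ℕ) (a : ℤ) :
    coeffMass S (monomial n a) = if S n then |a| else 0 :=
  Polynomial.sum_monomial_index _ _ (by simp)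

end coeffMass

/-- The sum of the absolute values of the coefficients of `f`. -/
def lengthNorm (f : ℤ[X]) : ℤ := coeffMass (fun _ => True) f

theorem lengthNorm_eq_sum (f : ℤ[X]) : lengthNorm f = f.sum fun _ a => |a| := by
  simp [lengthNorm, coeffMass]

theorem lengthNorm_eq_sum_range {f : ℤ[X]} {M : ℕ} (h : f.natDegree < M) :
    lengthNorm f = ∑ l ∈ Finset.range M, |f.coeff l| := by
  simpa [lengthNorm] using coeffMass_eq_sum_range (fun _ => True) h

theorem lengthNorm_nonneg (f : ℤ[X]) : 0 ≤ lengthNorm f := coeffMass_nonneg _ f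

theorem lengthNorm_monomial (n : ℕ) (a : ℤ) : lengthNorm (monomial n a) = |a| := by
  simp [lengthNorm, coeffMass_monomial]

theorem lengthNorm_neg (f : ℤ[X]) : lengthNorm (-f) = lengthNorm f := by
  rw [lengthNorm_eq_sum_range (M := f.natDegree + 1) (by simp),
    lengthNorm_eq_sum_range (Nat.lt_succ_self f.natDegree)]
  simp

theorem lengthNorm_sub_le (f g : ℤ[X]) :
    lengthNorm (f - g) ≤ lengthNorm f + lengthNorm g := by
  rw [sub_eq_add_neg, ← lengthNorm_neg g]
  exact coeffMass_add_le _ f (-g)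

theorem lengthNorm_sum_le {ι : Type*} (s : Finset ι) (f : ι → ℤ[X]) :
    lengthNorm (∑ i ∈ s, f i) ≤ ∑ i ∈ s, lengthNorm (f i) :=
  coeffMass_sum_le _ s f

theorem lengthNorm_X_pow (n : ℕ) : lengthNorm (X ^ n) = 1 := by
  rw [X_pow_eq_monomial, lengthNorm_monomial, abs_one]

theorem lengthNorm_X : lengthNorm X = 1 := by simpa using lengthNorm_X_pow 1

theorem lengthNorm_sum_X_pow_le (s : Finset ℕ) (e : ℕ → ℕ) :
    lengthNorm (∑ i ∈ s, X ^ e i) ≤ s.card :=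
  (lengthNorm_sum_le _ _).trans (by simp [lengthNorm_X_pow])

theorem coeffMass_mul_le (S : ℕ → Prop) [DecidablePred S] (f g : ℤ[X]) :
    coeffMass S (f * g) ≤
      ∑ j ∈ g.support, ∑ i ∈ f.support, if S (i + j) then |f.coeff i| * |g.coeff j| else 0 := by
  rw [Polynomial.mul_eq_sum_sum, Finset.sum_comm]
  refine (coeffMass_sum_le _ _ _).trans (Finset.sum_le_sum fun i _ => ?_)
  refine (coeffMass_sum_le _ _ _).trans (Finset.sum_le_sum fun j _ => ?_)
  rw [coeffMass_monomial, abs_mul]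

theorem lengthNorm_mul_le (f g : ℤ[X]) : lengthNorm (f * g) ≤ lengthNorm f * lengthNorm g := by
  refine (coeffMass_mul_le _ f g).trans ?_
  simp only [if_true, lengthNorm_eq_sum, Polynomial.sum_def]
  rw [Finset.sum_comm, Finset.sum_mul_sum]

theorem lengthNorm_expand_le (t : ℕ) (f : ℤ[X]) : lengthNorm (expand ℤ t f) ≤ lengthNorm f := by
  rw [expand_eq_sum, Polynomial.sum_def, lengthNorm_eq_sum f, Polynomial.sum_def]
  refine (lengthNorm_sum_le _ _).trans (Finset.sum_le_sum fun i _ => ?_)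
  rw [← pow_mul, C_mul_X_pow_eq_monomial, lengthNorm_monomial]

theorem abs_coeff_mul_le {f g : ℤ[X]} {A : ℤ} (hA : ∀ i, |f.coeff i| ≤ A) (k : ℕ) :
    |(f * g).coeff k| ≤ A * lengthNorm g := by
  have hA0 : 0 ≤ A := (abs_nonneg _).trans (hA 0)
  have hM : g.natDegree < max g.natDegree k + 1 := by omega
  rw [mul_comm f, coeff_mul, Finset.Nat.sum_antidiagonal_eq_sum_range_succ_mk,
    lengthNorm_eq_sum_range hM, Finset.mul_sum]
  refine (Finset.abs_sum_le_sum_abs _ _).trans ((Finset.sum_le_sum fun i _ => ?_).trans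
    (Finset.sum_le_sum_of_subset_of_nonneg
      (Finset.range_mono (show k.succ ≤ max g.natDegree k + 1 by omega))
      fun _ _ _ => by positivity))
  rw [abs_mul, mul_comm]
  exact mul_le_mul_of_nonneg_right (hA _) (abs_nonneg _)

/-- A sequence starting and ending at `0` reaches at most half of its total variation. -/
theorem two_mul_abs_le_sum_abs_sub {a : ℕ → ℤ} {j N : ℕ} (h0 : a 0 = 0) (hN : a N = 0)
    (hj : j ≤ N) : 2 * |a j| ≤ ∑ i ∈ Finset.range N, |a (i + 1) - a i| := by
  have h1 : a j = ∑ i ∈ Finset.range j, (a (i + 1) - a i) := by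
    rw [Finset.sum_range_sub, h0, sub_zero]
  have h2 : -a j = ∑ i ∈ Finset.Ico j N, (a (i + 1) - a i) := by
    rw [Finset.sum_Ico_sub _ hj, hN, zero_sub]
  have h3 : |a j| ≤ ∑ i ∈ Finset.range j, |a (i + 1) - a i| :=
    (congrArg abs h1).trans_le (Finset.abs_sum_le_sum_abs _ _)
  have h4 : |a j| ≤ ∑ i ∈ Finset.Ico j N, |a (i + 1) - a i| := by
    rw [← abs_neg]
    exact (congrArg abs h2).trans_le (Finset.abs_sum_le_sum_abs _ _)
  rw [← Finset.sum_range_add_sum_Ico _ hj]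
  linarith

/-- The total mass of `P * (X ^ m - 1)` on a residue class modulo `m` is at least twice
the absolute value of any coefficient of `P` in that class. -/
theorem two_mul_abs_coeff_le {m : ℕ} (hm : 0 < m) (P : ℤ[X]) (k : ℕ) :
    2 * |P.coeff k| ≤ coeffMass (fun l => l % m = k % m) (P * (X ^ m - 1)) := by
  set R := P * (X ^ m - 1) with hR
  set N := R.natDegree + P.natDegree + k + 2 with hN
  set a : ℕ → ℤ := fun i => if i = 0 then 0 else P.coeff (k % m + (i - 1) * m) with ha
  have hNm : N ≤ N * m := Nat.le_mul_of_pos_right _ hm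
  have haN : a N = 0 := by
    have h1 : N - 1 ≤ (N - 1) * m := Nat.le_mul_of_pos_right _ hm
    simp only [ha]
    rw [if_neg (by omega)]
    exact coeff_eq_zero_of_natDegree_lt (by omega)
  have hkN : k / m + 1 ≤ N := by
    have := Nat.div_le_self k m
    omega
  have hak : a (k / m + 1) = P.coeff k := by
    simp only [ha, Nat.add_one_ne_zero, if_false, Nat.add_sub_cancel]
    rw [Nat.mod_add_div' k m]
  have hstep : ∀ i, |a (i + 1) - a i| = |R.coeff (k % m + i * m)| := by
    intro i
    rw [hR, mul_sub, mul_one, coeff_sub, coeff_mul_X_pow', abs_sub_comm]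
    rcases i with _ | i
    · have := Nat.mod_lt k hm
      simp [ha, this.not_ge]
    · have h : k % m + (i + 1) * m - m = k % m + i * m := by
        rw [add_mul, one_mul]; omega
      have h' : m ≤ k % m + (i + 1) * m := by
        rw [add_mul, one_mul]; omega
      simp [ha, h, h']
  have hmain := two_mul_abs_le_sum_abs_sub (a := a) (by simp [ha]) haN hkN
  rw [hak] at hmain
  refine hmain.trans ?_
  rw [coeffMass_eq_sum_range (M := k % m + N * m) _ (by omega), ← Finset.sum_filter]
  have hinj : Set.InjOn (fun i => k % m + i * m) (Finset.range N : Set ℕ) := by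
    intro i _ j _ hij
    simpa [hm.ne'] using hij
  simp only [hstep]
  rw [← Finset.sum_image (f := fun l => |R.coeff l|) hinj]
  refine Finset.sum_le_sum_of_subset_of_nonneg ?_ fun _ _ _ => abs_nonneg _
  intro l hl
  obtain ⟨i, hi, rfl⟩ := Finset.mem_image.1 hl
  simp only [Finset.mem_filter, Finset.mem_range] at hi ⊢
  exact ⟨by gcongr, by simp⟩

theorem cyclotomic_mul_X_pow_sub_one {m t : ℕ} (ht : t.Prime) (hmt : ¬ t ∣ m) {H : ℤ[X]}
    (hH : cyclotomic m ℤ * H = X ^ m - 1) :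
    cyclotomic (m * t) ℤ * (X ^ m - 1) = expand ℤ t (cyclotomic m ℤ) * H := by
  rw [cyclotomic_expand_eq_cyclotomic_mul ht hmt, ← hH, mul_assoc]

theorem cyclotomic_mul_cofactor {m t : ℕ} (ht : t.Prime) (hmt : ¬ t ∣ m) {H : ℤ[X]}
    (hH : cyclotomic m ℤ * H = X ^ m - 1) :
    cyclotomic (m * t) ℤ * (cyclotomic m ℤ * expand ℤ t H) = X ^ (m * t) - 1 := by
  rw [← mul_assoc, ← cyclotomic_expand_eq_cyclotomic_mul ht hmt, ← map_mul, hH]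
  simp [← pow_mul, mul_comm]

theorem lengthNorm_cyclotomic_mul_le {m t : ℕ} (hm : 0 < m) (ht : t.Prime) (hmt : ¬ t ∣ m)
    (hdeg : 1 < m * t) {H : ℤ[X]} (hH : cyclotomic m ℤ * H = X ^ m - 1) :
    2 * lengthNorm (cyclotomic (m * t) ℤ) ≤
      t * (lengthNorm (cyclotomic m ℤ) * lengthNorm H) := by
  set P := cyclotomic (m * t) ℤ with hP
  set R := P * (X ^ m - 1) with hR
  have hPdeg : P.natDegree < m * t := by
    rw [hP, natDegree_cyclotomic]
    exact Nat.totient_lt _ hdeg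
  have hcount : ∀ l, ((Finset.range (m * t)).filter fun k => l % m = k % m).card = t := by
    intro l
    have h := Nat.count_modEq_card (m * t) hm l
    rw [Nat.count_eq_card_filter_range] at h
    simpa [Nat.ModEq, eq_comm, hm.ne'] using h
  have hRle : lengthNorm R ≤ lengthNorm (cyclotomic m ℤ) * lengthNorm H := by
    rw [hR, hP, cyclotomic_mul_X_pow_sub_one ht hmt hH]
    exact (lengthNorm_mul_le _ _).trans
      (mul_le_mul_of_nonneg_right (lengthNorm_expand_le _ _) (lengthNorm_nonneg _))
  calc 2 * lengthNorm P = ∑ k ∈ Finset.range (m * t), 2 * |P.coeff k| := by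
        rw [lengthNorm_eq_sum_range hPdeg, Finset.mul_sum]
    _ ≤ ∑ k ∈ Finset.range (m * t), coeffMass (fun l => l % m = k % m) R :=
        Finset.sum_le_sum fun k _ => two_mul_abs_coeff_le hm P k
    _ = t * lengthNorm R := by
        simp only [coeffMass, Polynomial.sum_def, lengthNorm_eq_sum]
        rw [Finset.sum_comm, Finset.mul_sum]
        refine Finset.sum_congr rfl fun l _ => ?_
        rw [← Finset.sum_filter, Finset.sum_const, hcount, nsmul_eq_mul]
    _ ≤ _ := mul_le_mul_of_nonneg_left hRle (by positivity)

theorem two_mul_abs_coeff_cyclotomic_mul_le {m t : ℕ} (hm : 1 < m) (ht : t.Prime)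
    (hmt : ¬ t ∣ m) {H : ℤ[X]} (hH : cyclotomic m ℤ * H = X ^ m - 1) {A : ℤ}
    (hA : ∀ i, |(cyclotomic m ℤ).coeff i| ≤ A) (k : ℕ) :
    2 * |(cyclotomic (m * t) ℤ).coeff k| ≤ A * lengthNorm H := by
  have hA0 : 0 ≤ A := (abs_nonneg _).trans (hA 0)
  have hcop : Nat.Coprime m t := ((Nat.Prime.coprime_iff_not_dvd ht).2 hmt).symm
  refine (two_mul_abs_coeff_le (by omega : 0 < m) _ k).trans ?_
  rw [cyclotomic_mul_X_pow_sub_one ht hmt hH]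
  refine (coeffMass_mul_le _ _ _).trans ?_
  rw [lengthNorm_eq_sum, Polynomial.sum_def, Finset.mul_sum]
  refine Finset.sum_le_sum fun j _ => ?_
  rw [← Finset.sum_filter]
  set s := (expand ℤ t (cyclotomic m ℤ)).support.filter fun i => (i + j) % m = k % m with hs
  have hcard : s.card ≤ 1 := by
    refine Finset.card_le_one.2 fun x hx y hy => ?_
    have key : ∀ x ∈ s, ∃ i < m, x = i * t ∧ (i * t + j) % m = k % m := by
      intro x hx
      simp only [hs, Finset.mem_filter, mem_support_iff, coeff_expand ht.pos] at hx
      obtain ⟨hx, hxj⟩ := hx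
      split_ifs at hx with hdvd
      · refine ⟨x / t, ?_, (Nat.div_mul_cancel hdvd).symm, by rwa [Nat.div_mul_cancel hdvd]⟩
        refine (le_natDegree_of_ne_zero hx).trans_lt ?_
        rw [natDegree_cyclotomic]
        exact Nat.totient_lt _ hm
      · exact absurd rfl hx
    obtain ⟨i, hi, rfl, hik⟩ := key x hx
    obtain ⟨i', hi', rfl, hik'⟩ := key y hy
    have h1 : i * t + j ≡ i' * t + j [MOD m] := hik.trans hik'.symm
    have h2 : i ≡ i' [MOD m] :=
      Nat.ModEq.cancel_right_of_coprime hcop (Nat.ModEq.add_right_cancel' j h1)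
    rw [h2.eq_of_lt_of_lt hi hi']
  have hB : ∀ i, |(expand ℤ t (cyclotomic m ℤ)).coeff i| ≤ A := by
    intro i
    rw [coeff_expand ht.pos]
    split_ifs
    · exact hA _
    · simpa using hA0
  calc _ ≤ ∑ i ∈ s, A * |H.coeff j| :=
        Finset.sum_le_sum fun i _ => mul_le_mul_of_nonneg_right (hB i) (abs_nonneg _)
    _ = s.card * (A * |H.coeff j|) := by rw [Finset.sum_const, nsmul_eq_mul]
    _ ≤ 1 * (A * |H.coeff j|) :=
        mul_le_mul_of_nonneg_right (by exact_mod_cast hcard) (by positivity)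
    _ = _ := one_mul _

theorem abs_coeff_cyclotomic_prime_le {p : ℕ} (hp : p.Prime) (i : ℕ) :
    |(cyclotomic p ℤ).coeff i| ≤ 1 := by
  have := Fact.mk hp
  rw [cyclotomic_prime]
  simp only [finsetSum_coeff, coeff_X_pow, Finset.sum_ite_eq]
  split_ifs <;> simp

theorem lengthNorm_cyclotomic_prime_le {p : ℕ} (hp : p.Prime) :
    lengthNorm (cyclotomic p ℤ) ≤ p := by
  have := Fact.mk hp
  rw [cyclotomic_prime]
  simpa using lengthNorm_sum_X_pow_le (Finset.range p) id

theorem exists_mul_add_mul_eq_s13 {p q : ℕ} (hp : 1 < p) (h : Nat.Coprime p q) :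
    ∃ u v, u ≤ p ∧ v ≤ q ∧ u * q + v * p = p * q + 1 := by
  obtain ⟨u, hup⟩ := Nat.exists_mul_mod_eq_one_of_coprime h.symm hp
  have hdiv := Nat.div_add_mod (q * u) p
  rw [hup.2] at hdiv
  have hle : q * u / p ≤ q := by
    refine Nat.div_le_of_le_mul ?_
    rw [mul_comm p q]
    exact Nat.mul_le_mul_left q hup.1.le
  refine ⟨u, q - q * u / p, hup.1.le, Nat.sub_le _ _, ?_⟩
  obtain ⟨c, hc⟩ := Nat.exists_eq_add_of_le hle
  set d := q * u / p
  rw [show q - d = c by omega]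
  nlinarith

theorem cyclotomic_mul_eq {p q u v : ℕ} (hp : p.Prime) (hq : q.Prime) (hpq : p ≠ q)
    (hu : u ≤ p) (hv : v ≤ q) (h : u * q + v * p = p * q + 1) :
    cyclotomic (p * q) ℤ =
      (∑ b ∈ Finset.range u, X ^ (q * b)) * (∑ a ∈ Finset.range v, X ^ (p * a)) -
      X * ((∑ b ∈ Finset.range (p - u), X ^ (q * b)) *
        ∑ a ∈ Finset.range (q - v), X ^ (p * a)) := by
  obtain ⟨u', rfl⟩ := Nat.exists_eq_add_of_le hu
  obtain ⟨v', rfl⟩ := Nat.exists_eq_add_of_le hv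
  set p := u + u' with hpdef
  set q := v + v' with hqdef
  have := Fact.mk hp
  have hX : ∀ n : ℕ, n ≠ 0 → (X ^ n - 1 : ℤ[X]) ≠ 0 := fun n hn =>
    (monic_X_pow_sub_C (1 : ℤ) hn).ne_zero
  have hdvd : ¬ q ∣ p := fun hd => hpq ((Nat.prime_dvd_prime_iff_eq hq hp).1 hd).symm
  have h1 : cyclotomic (p * q) ℤ * cyclotomic p ℤ = expand ℤ q (cyclotomic p ℤ) :=
    (cyclotomic_expand_eq_cyclotomic_mul hq hdvd ℤ).symm
  have h2 : cyclotomic p ℤ * (X - 1) = X ^ p - 1 := cyclotomic_prime_mul_X_sub_one ℤ p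
  have h3 : expand ℤ q (cyclotomic p ℤ) * (X ^ q - 1) = X ^ (p * q) - 1 := by
    have := congrArg (expand ℤ q) h2
    simpa [← pow_mul, mul_comm q p] using this
  have h4 : cyclotomic (p * q) ℤ * ((X ^ p - 1) * (X ^ q - 1)) =
      (X ^ (p * q) - 1) * (X - 1) := by
    rw [← h3, ← h2, ← h1]; ring
  have geom : ∀ d n : ℕ, (∑ b ∈ Finset.range n, (X : ℤ[X]) ^ (d * b)) * (X ^ d - 1) =
      X ^ (d * n) - 1 := by
    intro d n
    simp only [pow_mul]
    exact geom_sum_mul _ _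
  refine mul_right_cancel₀ (mul_ne_zero (hX p hp.ne_zero) (hX q hq.ne_zero)) ?_
  rw [h4]
  have e1 := geom q u
  have e2 := geom p v
  have e3 := geom q u'
  have e4 := geom p v'
  rw [Nat.add_sub_cancel_left, Nat.add_sub_cancel_left]
  have f1 : X * (X : ℤ[X]) ^ (q * u') = X ^ (p * v) := by
    rw [← pow_succ']; congr 1; rw [hpdef] at h ⊢; nlinarith
  have f2 : X * (X : ℤ[X]) ^ (p * v') = X ^ (q * u) := by
    rw [← pow_succ']; congr 1; rw [hqdef] at h ⊢; nlinarith
  have f3 : (X : ℤ[X]) ^ (p * v) * X ^ (p * v') = X ^ (p * q) := by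
    rw [← pow_add, ← mul_add]
  have f4 : (X : ℤ[X]) ^ (q * u) * X ^ (p * v) = X ^ (p * q) * X := by
    rw [← pow_add, ← pow_succ]; congr 1; rw [← h]; ring
  linear_combination
    -(∑ a ∈ Finset.range v, (X : ℤ[X]) ^ (p * a)) * (X ^ p - 1) * e1 - (X ^ (q * u) - 1) * e2 +
    X * (∑ a ∈ Finset.range v', (X : ℤ[X]) ^ (p * a)) * (X ^ p - 1) * e3 +
    X * (X ^ (q * u') - 1) * e4 + (X ^ (p * v') - 1) * f1 + f3 - f2 - f4

theorem two_mul_lengthNorm_cyclotomic_mul_le {p q : ℕ} (hp : p.Prime) (hq : q.Prime)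
    (hpq : p ≠ q) : 2 * lengthNorm (cyclotomic (p * q) ℤ) ≤ p * q + 1 := by
  obtain ⟨u, v, hu, hv, h⟩ :=
    exists_mul_add_mul_eq_s13 hp.one_lt ((Nat.coprime_primes hp hq).2 hpq)
  have hL : lengthNorm (cyclotomic (p * q) ℤ) ≤ u * v + (p - u : ℤ) * (q - v : ℤ) := by
    have geom : ∀ d n : ℕ, lengthNorm (∑ b ∈ Finset.range n, X ^ (d * b)) ≤ n := fun d n => by
      simpa using lengthNorm_sum_X_pow_le (Finset.range n) (d * ·)
    have prod : ∀ d e m n : ℕ, lengthNorm ((∑ b ∈ Finset.range m, X ^ (d * b)) *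
        ∑ a ∈ Finset.range n, X ^ (e * a)) ≤ m * n := fun d e m n =>
      (lengthNorm_mul_le _ _).trans
        (mul_le_mul (geom d m) (geom e n) (lengthNorm_nonneg _) (by positivity))
    rw [cyclotomic_mul_eq hp hq hpq hu hv h]
    refine (lengthNorm_sub_le _ _).trans (add_le_add (prod q p u v) ?_)
    refine (lengthNorm_mul_le _ _).trans ?_
    rw [lengthNorm_X, one_mul]
    simpa [Nat.cast_sub hu, Nat.cast_sub hv] using prod q p (p - u) (q - v)
  have h' : (u * q + v * p : ℤ) = p * q + 1 := by exact_mod_cast h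
  have hpq4 : (2 * 2 : ℤ) ≤ p * q := by
    exact_mod_cast Nat.mul_le_mul hp.two_le hq.two_le
  have hsq : 4 * (u * v : ℤ) * (p * q) ≤ (p * q + 1) ^ 2 := by
    rw [← h']
    nlinarith [sq_nonneg ((u : ℤ) * q - v * p)]
  have huv : 4 * (u * v : ℤ) < p * q + 4 := by
    by_contra! hcon
    nlinarith
  linarith

theorem polyHeight_le {f : ℤ[X]} {B : ℤ} (hB : ∀ i, |f.coeff i| ≤ B) : (polyHeight f : ℤ) ≤ B := by
  have hB0 : 0 ≤ B := (abs_nonneg _).trans (hB 0)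
  lift B to ℕ using hB0
  refine Int.ofNat_le.2 (Finset.sup_le fun i _ => ?_)
  have := hB i
  rw [Int.abs_eq_natAbs] at this
  exact_mod_cast this

theorem Cinv_eq_polyHeight {n : ℕ} {H : ℤ[X]} (hH : cyclotomic n ℤ * H = X ^ n - 1) :
    Cinv n = polyHeight H := by
  rw [Cinv, ← hH, mul_divByMonic_cancel_left _ (cyclotomic.monic n ℤ)]

/-- **(Bzdęga, bound (6)).** For odd primes `p < q < r < s < t`,
`C (pqrst) ≤ (9/16)·p⁷q³r`. -/
theorem height_cyclotomic_stmt13 (p q r s t : ℕ)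
    (hp : p.Prime) (hq : q.Prime) (hr : r.Prime) (hs : s.Prime) (ht : t.Prime)
    (hop : Odd p) (hoq : Odd q) (hor : Odd r) (hos : Odd s) (hot : Odd t)
    (hpq : p < q) (hqr : q < r) (hrs : r < s) (hst : s < t) :
    (Cinv (p * q * r * s * t) : ℝ) ≤ (9 / 16) * (p : ℝ) ^ 7 * (q : ℝ) ^ 3 * r := by
  have hdvd : ∀ {a b : ℕ}, a.Prime → b.Prime → a < b → ¬ b ∣ a := fun ha _ hab hd =>
    absurd (Nat.le_of_dvd ha.pos hd) (by omega)
  have hq_p : ¬ q ∣ p := hdvd hp hq hpq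
  have hr_pq : ¬ r ∣ p * q := by
    rw [hr.dvd_mul]
    exact not_or.2 ⟨hdvd hp hr (by omega), hdvd hq hr hqr⟩
  have hs_pqr : ¬ s ∣ p * q * r := by
    rw [hs.dvd_mul, hs.dvd_mul]
    exact not_or.2 ⟨not_or.2 ⟨hdvd hp hs (by omega), hdvd hq hs (by omega)⟩, hdvd hr hs hrs⟩
  have ht_pqrs : ¬ t ∣ p * q * r * s := by
    rw [ht.dvd_mul, ht.dvd_mul, ht.dvd_mul]
    exact not_or.2 ⟨not_or.2 ⟨not_or.2 ⟨hdvd hp ht (by omega), hdvd hq ht (by omega)⟩,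
      hdvd hr ht (by omega)⟩, hdvd hs ht hst⟩
  have hpq1 : 1 < p * q := Nat.one_lt_mul_iff.2 ⟨hp.pos, hq.pos, Or.inl hp.one_lt⟩
  have hpqr1 : 1 < p * q * r := Nat.one_lt_mul_iff.2 ⟨by omega, hr.pos, Or.inl hpq1⟩
  have := Fact.mk hp
  have hH₁ : cyclotomic p ℤ * (X - 1) = X ^ p - 1 := cyclotomic_prime_mul_X_sub_one ℤ p
  have hH₂ := cyclotomic_mul_cofactor hq hq_p hH₁
  have hH₃ := cyclotomic_mul_cofactor hr hr_pq hH₂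
  have hH₄ := cyclotomic_mul_cofactor hs hs_pqr hH₃
  have hH₅ := cyclotomic_mul_cofactor ht ht_pqrs hH₄
  set H₁ : ℤ[X] := X - 1
  set H₂ := cyclotomic p ℤ * expand ℤ q H₁
  set H₃ := cyclotomic (p * q) ℤ * expand ℤ r H₂
  set H₄ := cyclotomic (p * q * r) ℤ * expand ℤ s H₃
  set L := lengthNorm (cyclotomic (p * q) ℤ)
  have hL0 : 0 ≤ L := lengthNorm_nonneg _
  have hL : 2 * L ≤ p * q + 1 := two_mul_lengthNorm_cyclotomic_mul_le hp hq hpq.ne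
  have hcof : ∀ (f g : ℤ[X]) (k : ℕ) (a b : ℤ), lengthNorm f ≤ a → lengthNorm g ≤ b →
      lengthNorm (f * expand ℤ k g) ≤ a * b := fun f g k a b ha hb =>
    (lengthNorm_mul_le _ _).trans (mul_le_mul ha ((lengthNorm_expand_le _ _).trans hb)
      (lengthNorm_nonneg _) ((lengthNorm_nonneg _).trans ha))
  have hl₁ : lengthNorm H₁ ≤ 2 := by
    refine (lengthNorm_sub_le _ _).trans ?_
    have h1 : lengthNorm 1 = 1 := by simpa using lengthNorm_X_pow 0
    rw [lengthNorm_X, h1]; norm_num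
  have hl₂ : lengthNorm H₂ ≤ p * 2 := hcof _ _ _ _ _ (lengthNorm_cyclotomic_prime_le hp) hl₁
  have hl₃ : lengthNorm H₃ ≤ L * (p * 2) := hcof _ _ _ _ _ le_rfl hl₂
  have hΦ₃ : lengthNorm (cyclotomic (p * q * r) ℤ) ≤ r * (L * p) := by
    have h := lengthNorm_cyclotomic_mul_le (by omega) hr hr_pq hpqr1 hH₂
    have h' : (r : ℤ) * (L * lengthNorm H₂) ≤ r * (L * (p * 2)) := by gcongr
    linarith
  have hl₄ : lengthNorm H₄ ≤ r * (L * p) * (L * (p * 2)) := hcof _ _ _ _ _ hΦ₃ hl₃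
  have hA₂ : ∀ i, |(cyclotomic (p * q) ℤ).coeff i| ≤ 1 := fun i => by
    have := two_mul_abs_coeff_cyclotomic_mul_le hp.one_lt hq hq_p hH₁
      (abs_coeff_cyclotomic_prime_le hp) i
    linarith
  have hA₃ : ∀ i, |(cyclotomic (p * q * r) ℤ).coeff i| ≤ p := fun i => by
    have := two_mul_abs_coeff_cyclotomic_mul_le hpq1 hr hr_pq hH₂ hA₂ i
    linarith
  have hA₄ : ∀ i, |(cyclotomic (p * q * r * s) ℤ).coeff i| ≤ p * (L * p) := fun i => by
    have h := two_mul_abs_coeff_cyclotomic_mul_le hpqr1 hs hs_pqr hH₃ hA₃ i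
    have h' : (p : ℤ) * lengthNorm H₃ ≤ p * (L * (p * 2)) := by gcongr
    linarith
  have hfinal : (Cinv (p * q * r * s * t) : ℤ) ≤
      p * (L * p) * (r * (L * p) * (L * (p * 2))) := by
    rw [Cinv_eq_polyHeight hH₅]
    refine polyHeight_le fun i => (abs_coeff_mul_le hA₄ i).trans ?_
    exact mul_le_mul_of_nonneg_left ((lengthNorm_expand_le _ _).trans hl₄) (by positivity)
  have hfinalR : (Cinv (p * q * r * s * t) : ℝ) ≤
      p * (L * p) * (r * (L * p) * (L * (p * 2))) := by exact_mod_cast hfinal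
  have hLR : 2 * (L : ℝ) ≤ p * q + 1 := by exact_mod_cast hL
  have hLR0 : (0 : ℝ) ≤ L := by exact_mod_cast hL0
  have hpq15 : (15 : ℝ) ≤ p * q := by
    have h3 : 3 ≤ p := by
      have := hp.two_le
      obtain ⟨c, hc⟩ := hop
      omega
    have h5 : 5 ≤ q := by
      obtain ⟨c, hc⟩ := hop
      obtain ⟨d, hd⟩ := hoq
      omega
    exact_mod_cast Nat.mul_le_mul h3 h5
  have hL' : (L : ℝ) ≤ 8 / 15 * (p * q) := by linarith
  have hL3 : (L : ℝ) ^ 3 ≤ (8 / 15 * (p * q)) ^ 3 := by gcongr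
  calc (Cinv (p * q * r * s * t) : ℝ) ≤ p * (L * p) * (r * (L * p) * (L * (p * 2))) := hfinalR
    _ = 2 * p ^ 4 * r * (L : ℝ) ^ 3 := by ring
    _ ≤ 2 * p ^ 4 * r * (8 / 15 * (p * q)) ^ 3 := by gcongr
    _ = 1024 / 3375 * ((p : ℝ) ^ 7 * q ^ 3 * r) := by ring
    _ ≤ 9 / 16 * ((p : ℝ) ^ 7 * q ^ 3 * r) :=
        mul_le_mul_of_nonneg_right (by norm_num) (by positivity)
    _ = _ := by ring
end
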